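/- arXiv:2205.13981 — 9 statements merged into one kernel-verified Lean document; each statement's English description precedes it below -/
import Mathlib

section
/- Let p be an odd prime. For all θ₁, θ₂ ∈ ZMod (p²), the Gray map satisfies φ(θ₁ + θ₂) = φ(θ₁) + φ(θ₂) + φ(p · c(θ₁, θ₂)), where c(θ₁, θ₂) = 1 if (θ₁.val % p) + (θ₂.val % p) ≥ p and c(θ₁, θ₂) = 0 otherwise (the sum θ₁ + θ₂ is taken in ZMod (p²), the sums of Gray images are taken coordinatewise in Fin p → ZMod p). -/
/-- The Gray map `φ : ZMod (p²) → (Fin p → ZMod p)`, sending `θ = p·θ'' + θ'`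
(with `θ', θ'' ∈ {0,…,p−1}`) to the vector whose `i`-th coordinate is `θ'' + θ'·i`. -/
def gray (p : ℕ) (θ : ZMod (p ^ 2)) : Fin p → ZMod p :=
  fun i => ((θ.val / p : ℕ) : ZMod p) + ((θ.val % p : ℕ) : ZMod p) * ((i : ℕ) : ZMod p)

/-- The carry `c(u,v)`: `1` if `(u.val % p) + (v.val % p) ≥ p`, else `0`. -/
def carry (p : ℕ) (u v : ZMod (p ^ 2)) : ℕ :=
  if p ≤ u.val % p + v.val % p then 1 else 0

theorem gray_natCast_aux (p : ℕ) (n : ℕ) (i : Fin p) :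
    gray p (n : ZMod (p ^ 2)) i =
      ((n / p : ℕ) : ZMod p) + (n : ZMod p) * ((i : ℕ) : ZMod p) := by
  unfold gray
  rw [ZMod.val_natCast, pow_two, Nat.mod_mul_right_div_self, Nat.mod_mul_right_mod,
    ZMod.natCast_mod, ZMod.natCast_mod]

theorem gray_add (p : ℕ) (hp : p.Prime) (hodd : Odd p) (θ₁ θ₂ : ZMod (p ^ 2)) :
    gray p (θ₁ + θ₂) =
      gray p θ₁ + gray p θ₂ +
        gray p ((p : ZMod (p ^ 2)) * ((carry p θ₁ θ₂ : ℕ) : ZMod (p ^ 2))) := by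
  haveI : NeZero (p ^ 2) := ⟨pow_ne_zero 2 hp.ne_zero⟩
  have h1 : θ₁ = ((θ₁.val : ℕ) : ZMod (p ^ 2)) := (ZMod.natCast_zmod_val θ₁).symm
  have h2 : θ₂ = ((θ₂.val : ℕ) : ZMod (p ^ 2)) := (ZMod.natCast_zmod_val θ₂).symm
  have hc : (θ₁.val + θ₂.val) / p = θ₁.val / p + θ₂.val / p + carry p θ₁ θ₂ :=
    Nat.add_div hp.pos
  generalize carry p θ₁ θ₂ = c at hc ⊢
  generalize θ₁.val = a at h1 hc
  generalize θ₂.val = b at h2 hc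
  subst h1 h2
  funext i
  rw [Pi.add_apply, Pi.add_apply, ← Nat.cast_add, ← Nat.cast_mul]
  simp only [gray_natCast_aux]
  rw [hc, Nat.mul_div_cancel_left _ hp.pos]
  push_cast
  rw [ZMod.natCast_self]
  ring
end

section
/- Let p be an odd prime and α, β : ℕ. For all u, v ∈ (Fin α → ZMod p) × (Fin β → ZMod (p²)), the extended Gray map satisfies Φ(u + v) = Φ(u) + Φ(v) + Φ(pP(u,v)), where pP(u,v) is the element of (Fin α → ZMod p) × (Fin β → ZMod (p²)) whose first component is 0 and whose j-th coordinate in the second component is p · c(u_j, v_j). -/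
/-- The extended Gray map `Φ`. -/
def Gray (p α β : ℕ) (u : (Fin α → ZMod p) × (Fin β → ZMod (p ^ 2))) :
    (Fin α → ZMod p) × (Fin β → Fin p → ZMod p) :=
  (u.1, fun j => gray p (u.2 j))

/-- The vector `pP(u,v)` with first component `0` and `j`-th second-component
coordinate `p · c(u_j, v_j)`. -/
def pP (p α β : ℕ) (u v : (Fin α → ZMod p) × (Fin β → ZMod (p ^ 2))) :
    (Fin α → ZMod p) × (Fin β → ZMod (p ^ 2)) :=
  (0, fun j => (p : ZMod (p ^ 2)) * ((carry p (u.2 j) (v.2 j) : ℕ) : ZMod (p ^ 2)))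

theorem gray_add_aux (p : ℕ) (hp : p.Prime) (a b : ZMod (p ^ 2)) (i : Fin p) :
    gray p (a + b) i = gray p a i + gray p b i +
      gray p ((p : ZMod (p ^ 2)) * ((carry p a b : ℕ) : ZMod (p ^ 2))) i := by
  have hp2 := hp.two_le
  have hpos := hp.pos
  have : NeZero (p ^ 2) := ⟨by positivity⟩
  have hc : carry p a b ≤ 1 := by unfold carry; split_ifs <;> simp
  have h1 : ((p : ZMod (p ^ 2)) * ((carry p a b : ℕ) : ZMod (p ^ 2))).val = p * carry p a b := by
    rw [← Nat.cast_mul, ZMod.val_natCast, Nat.mod_eq_of_lt]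
    nlinarith
  have h2 : (a + b).val / p = ((a.val + b.val) / p) % p := by
    rw [ZMod.val_add]; generalize a.val + b.val = n; rw [pow_two, Nat.mod_mul_right_div_self]
  have h3 : (a + b).val % p = (a.val + b.val) % p := by
    rw [ZMod.val_add]; generalize a.val + b.val = n; rw [pow_two, Nat.mod_mul_right_mod]
  have h4 : (a.val + b.val) / p = a.val / p + b.val / p + carry p a b := by
    rw [Nat.add_div hpos]; rfl
  unfold gray
  rw [h1, h2, h3, h4, Nat.mul_div_cancel_left _ hpos, Nat.mul_mod_right]
  simp only [ZMod.natCast_mod]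
  push_cast
  ring

theorem Gray_add (p : ℕ) (hp : p.Prime) (hodd : Odd p) (α β : ℕ)
    (u v : (Fin α → ZMod p) × (Fin β → ZMod (p ^ 2))) :
    Gray p α β (u + v) = Gray p α β u + Gray p α β v + Gray p α β (pP p α β u v) := by
  refine Prod.ext ?_ ?_
  · simp [Gray, pP]
  · funext j i
    exact gray_add_aux p hp (u.2 j) (v.2 j) i
end

section
/- Let α, β : ℕ. For all u, v ∈ (Fin α → ZMod 3) × (Fin β → ZMod 9), the extended Gray map satisfies Φ(u + v) = Φ(u) + Φ(v) + 2 • Φ(3 • (u ∗ v + u ∗ u ∗ v + u ∗ v ∗ v)), where ∗ denotes componentwise multiplication on each factor. -/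
/-- The Gray map `φ : ZMod 9 → (Fin 3 → ZMod 3)`. -/
def gray3 (θ : ZMod 9) : Fin 3 → ZMod 3 :=
  fun i => ((θ.val / 3 : ℕ) : ZMod 3) + ((θ.val % 3 : ℕ) : ZMod 3) * ((i : ℕ) : ZMod 3)

/-- The extended Gray map `Φ`. -/
def Gray3 (α β : ℕ) (u : (Fin α → ZMod 3) × (Fin β → ZMod 9)) :
    (Fin α → ZMod 3) × (Fin β → Fin 3 → ZMod 3) :=
  (u.1, fun j => gray3 (u.2 j))

theorem gray3_add_aux : ∀ (x y : ZMod 9) (i : Fin 3),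
    gray3 (x + y) i = gray3 x i + gray3 y i +
      (2 : ℕ) • gray3 ((3 : ℕ) • (x * y + x * x * y + x * y * y)) i := by
  unfold gray3
  decide +kernel

theorem zmod3_three_nsmul : ∀ x : ZMod 3, (2 : ℕ) • ((3 : ℕ) • x) = 0 := by
  decide

/-- `Φ(u + v) = Φ(u) + Φ(v) + 2 • Φ(3 • (u∗v + u∗u∗v + u∗v∗v))`, where `∗` is
componentwise multiplication (the `Prod`/`Pi` multiplication). -/
theorem Gray3_add (α β : ℕ) (u v : (Fin α → ZMod 3) × (Fin β → ZMod 9)) :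
    Gray3 α β (u + v) =
      Gray3 α β u + Gray3 α β v +
        (2 : ℕ) • Gray3 α β ((3 : ℕ) • (u * v + u * u * v + u * v * v)) := by
  refine Prod.ext ?_ ?_
  · funext j
    change u.1 j + v.1 j = u.1 j + v.1 j + (2 : ℕ) • ((3 : ℕ) • _)
    rw [zmod3_three_nsmul, add_zero]
  · funext j i
    exact gray3_add_aux (u.2 j) (v.2 j) i
end

section
/- Let p be an odd prime, α, β : ℕ, 𝒞 an additive subgroup of (Fin α → ZMod p) × (Fin β → ZMod (p²)), and C = Φ '' 𝒞. For any n : ℕ and any elements x₁, …, xₙ ∈ 𝒞, if Φ(x₁) + Φ(x₂) + ⋯ + Φ(xₙ) ∈ K(C), then Φ(x₁ + x₂ + ⋯ + xₙ) ∈ K(C). -/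
/-- The kernel `K(C) = {x : x + C = C}` of a subset `C`. -/
def kernelSet {V : Type*} [AddCommGroup V] (C : Set V) : Set V :=
  {x | (fun c => x + c) '' C = C}

theorem gray_natCast (p : ℕ) (m : ℕ) (i : Fin p) :
    gray p (m : ZMod (p ^ 2)) i = ((m / p : ℕ) : ZMod p) + (m : ZMod p) * ((i : ℕ) : ZMod p) := by
  unfold gray
  have h1 : (m % p ^ 2) / p = (m / p) % p := by
    rw [pow_two, Nat.mod_mul_right_div_self]
  have h2 : (m % p ^ 2) % p = m % p := Nat.mod_mod_of_dvd _ (Dvd.intro_left p (pow_two p).symm)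
  rw [ZMod.val_natCast, h1, h2, ZMod.natCast_mod, ZMod.natCast_mod]

/-- Reduction modulo `p`. -/
def redHom (p : ℕ) : ZMod (p ^ 2) →+* ZMod p :=
  ZMod.castHom (Dvd.intro_left p (pow_two p).symm) (ZMod p)

theorem gray_diff (p : ℕ) (hp : p.Prime) (θ : ZMod (p ^ 2)) :
    gray p θ ⟨1, hp.one_lt⟩ - gray p θ ⟨0, hp.pos⟩ = redHom p θ := by
  haveI : NeZero (p ^ 2) := ⟨pow_ne_zero 2 hp.ne_zero⟩
  rw [← ZMod.natCast_zmod_val θ, gray_natCast, gray_natCast, map_natCast]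
  simp

theorem gray_add_s7 (p : ℕ) (hp : p.Prime) (d v : ZMod (p ^ 2)) (hd : redHom p d = 0) :
    gray p (d + v) = gray p d + gray p v := by
  haveI : NeZero (p ^ 2) := ⟨pow_ne_zero 2 hp.ne_zero⟩
  rw [← ZMod.natCast_zmod_val d, map_natCast, ZMod.natCast_eq_zero_iff] at hd
  obtain ⟨k, hk⟩ := hd
  rw [← ZMod.natCast_zmod_val d, ← ZMod.natCast_zmod_val v, hk, ← Nat.cast_add]
  funext i
  rw [Pi.add_apply, gray_natCast, gray_natCast, gray_natCast, Nat.mul_add_div hp.pos,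
    Nat.mul_div_cancel_left _ hp.pos]
  push_cast
  ring

theorem kernelSet_add {V : Type*} [AddCommGroup V] {C : Set V} {a b : V}
    (ha : a ∈ kernelSet C) (hb : b ∈ kernelSet C) : a + b ∈ kernelSet C := by
  unfold kernelSet at *
  simp only [Set.mem_setOf_eq] at *
  conv_rhs => rw [← ha, ← hb]
  rw [Set.image_image]
  simp only [add_assoc]

/-- If `Φ(x₁) + ⋯ + Φ(xₙ) ∈ K(C)` for `x₁, …, xₙ ∈ 𝒞`, then `Φ(x₁ + ⋯ + xₙ) ∈ K(C)`. -/
theorem sum_Gray_mem_kernel (p : ℕ) (hp : p.Prime) (hodd : Odd p) (α β : ℕ)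
    (𝒞 : AddSubgroup ((Fin α → ZMod p) × (Fin β → ZMod (p ^ 2))))
    (n : ℕ) (x : Fin n → (Fin α → ZMod p) × (Fin β → ZMod (p ^ 2)))
    (hx : ∀ i, x i ∈ 𝒞)
    (h : (∑ i, Gray p α β (x i)) ∈
      kernelSet (Gray p α β '' (𝒞 : Set ((Fin α → ZMod p) × (Fin β → ZMod (p ^ 2)))))) :
    Gray p α β (∑ i, x i) ∈
      kernelSet (Gray p α β '' (𝒞 : Set ((Fin α → ZMod p) × (Fin β → ZMod (p ^ 2))))) := by
  set X := ∑ i, x i with hX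
  have hX𝒞 : X ∈ 𝒞 := sum_mem fun i _ => hx i
  have h0 : Gray p α β 0 = 0 := by
    ext <;> simp [Gray, gray]
  have hw : (∑ i, Gray p α β (x i)) ∈
      Gray p α β '' (𝒞 : Set ((Fin α → ZMod p) × (Fin β → ZMod (p ^ 2)))) := by
    have h' := h
    unfold kernelSet at h'
    rw [Set.mem_setOf_eq] at h'
    rw [← h']
    exact ⟨0, ⟨0, 𝒞.zero_mem, h0⟩, add_zero _⟩
  obtain ⟨w, hw𝒞, hw⟩ := hw
  rw [← hw] at h
  have hred : ∀ j, redHom p ((X - w).2 j) = 0 := by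
    intro j
    have e : ∀ k, gray p (w.2 j) k = ∑ i, gray p ((x i).2 j) k := by
      intro k
      have := congrArg (fun z => z.2 j k) hw
      simpa [Gray, Prod.snd_sum, Finset.sum_apply] using this
    rw [Prod.snd_sub, Pi.sub_apply, map_sub, ← gray_diff p hp (w.2 j), e, e,
      ← Finset.sum_sub_distrib, hX, Prod.snd_sum, Finset.sum_apply, map_sum, sub_eq_zero]
    exact Finset.sum_congr rfl fun i _ => (gray_diff p hp _).symm
  have hadd : ∀ v, Gray p α β (X - w) + Gray p α β v = Gray p α β (X - w + v) := by
    intro v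
    refine Prod.ext rfl ?_
    funext j
    exact (gray_add_s7 p hp _ _ (hred j)).symm
  have hd : X - w ∈ 𝒞 := 𝒞.sub_mem hX𝒞 hw𝒞
  have hdK : Gray p α β (X - w) ∈ kernelSet
      (Gray p α β '' (𝒞 : Set ((Fin α → ZMod p) × (Fin β → ZMod (p ^ 2))))) := by
    unfold kernelSet
    rw [Set.mem_setOf_eq]
    ext z
    constructor
    · rintro ⟨_, ⟨v, hv, rfl⟩, rfl⟩
      exact ⟨_, 𝒞.add_mem hd hv, (hadd v).symm⟩
    · rintro ⟨v, hv, rfl⟩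
      refine ⟨_, ⟨v - (X - w), 𝒞.sub_mem hv hd, rfl⟩, ?_⟩
      simp only [hadd, add_sub_cancel]
  have := kernelSet_add hdK h
  rwa [hadd, sub_add_cancel] at this
end

section
/- Let p be an odd prime, α, β : ℕ, 𝒞 an additive subgroup of (Fin α → ZMod p) × (Fin β → ZMod (p²)), and C = Φ '' 𝒞. For any x ∈ 𝒞 and any natural number a, if a • Φ(x) ∈ K(C) then Φ(a • x) ∈ K(C). -/
theorem gray_add_of_dvd (p : ℕ) (hp : p.Prime) (z v : ZMod (p ^ 2)) (hz : p ∣ z.val) :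
    gray p (z + v) = gray p z + gray p v := by
  have hp0 : 0 < p := hp.pos
  have : NeZero (p ^ 2) := ⟨(pow_pos hp0 2).ne'⟩
  obtain ⟨k, hk⟩ := hz
  funext i
  simp only [gray, Pi.add_apply]
  rw [ZMod.val_add, hk]
  generalize v.val = m
  rw [pow_two, Nat.mod_mul_right_div_self, Nat.mod_mul_right_mod,
    Nat.mul_add_div hp0, Nat.mul_add_mod, Nat.mul_div_cancel_left _ hp0, Nat.mul_mod_right]
  rw [ZMod.natCast_mod]
  push_cast
  ring

theorem dvd_of_gray_eq (p : ℕ) (hp : p.Prime) (a : ℕ) (x w : ZMod (p ^ 2))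
    (h : gray p w = a • gray p x) : p ∣ (a • x - w).val := by
  have hp0 : 0 < p := hp.pos
  have : NeZero (p ^ 2) := ⟨(pow_pos hp0 2).ne'⟩
  have h0 := congrFun h ⟨0, hp0⟩
  have h1 := congrFun h ⟨1, hp.one_lt⟩
  simp only [gray, Pi.smul_apply, ZMod.natCast_mod, Nat.cast_zero, mul_zero, add_zero,
    Nat.cast_one, mul_one, smul_add] at h0 h1
  rw [h0] at h1
  have h2 := add_left_cancel h1
  have hd : p ∣ p ^ 2 := dvd_pow_self p two_ne_zero
  have key : ∀ y : ZMod (p ^ 2), ((y.val : ℕ) : ZMod p) = ZMod.castHom hd (ZMod p) y := by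
    intro y
    rw [ZMod.castHom_apply, ZMod.natCast_val]
  rw [← ZMod.natCast_eq_zero_iff, key, map_sub, map_nsmul, ← key, ← key, h2, sub_self]

/-- For `x ∈ 𝒞` and `a : ℕ`, if `a • Φ(x) ∈ K(C)` then `Φ(a • x) ∈ K(C)`. -/
theorem smul_Gray_mem_kernel (p : ℕ) (hp : p.Prime) (hodd : Odd p) (α β : ℕ)
    (𝒞 : AddSubgroup ((Fin α → ZMod p) × (Fin β → ZMod (p ^ 2))))
    (x : (Fin α → ZMod p) × (Fin β → ZMod (p ^ 2))) (hx : x ∈ 𝒞) (a : ℕ)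
    (h : a • Gray p α β x ∈
      kernelSet (Gray p α β '' (𝒞 : Set ((Fin α → ZMod p) × (Fin β → ZMod (p ^ 2)))))) :
    Gray p α β (a • x) ∈
      kernelSet (Gray p α β '' (𝒞 : Set ((Fin α → ZMod p) × (Fin β → ZMod (p ^ 2))))) := by
  have hG0 : Gray p α β 0 = 0 := by
    ext <;> simp [Gray, gray]
  have hw : a • Gray p α β x ∈ Gray p α β '' (𝒞 : Set _) := by
    have h' : (fun c => a • Gray p α β x + c) '' (Gray p α β '' (𝒞 : Set _))
      = Gray p α β '' (𝒞 : Set _) := h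
    rw [← h']
    exact ⟨0, ⟨0, 𝒞.zero_mem, hG0⟩, add_zero _⟩
  obtain ⟨w, hwC, hw⟩ := hw
  have hz : a • x - w ∈ 𝒞 := 𝒞.sub_mem (𝒞.nsmul_mem hx a) hwC
  have hadd : ∀ v, Gray p α β (a • x - w + v) = Gray p α β (a • x - w) + Gray p α β v := by
    intro v
    refine Prod.ext rfl ?_
    funext j
    exact gray_add_of_dvd p hp _ _
      (dvd_of_gray_eq p hp a (x.2 j) (w.2 j) (congrFun (congrArg Prod.snd hw) j))
  have hax : Gray p α β (a • x) = Gray p α β (a • x - w) + a • Gray p α β x := by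
    rw [← hw, ← hadd, sub_add_cancel]
  have hset : (fun c => Gray p α β (a • x - w) + c) '' (Gray p α β '' (𝒞 : Set _))
      = Gray p α β '' (𝒞 : Set _) := by
    ext c
    constructor
    · rintro ⟨_, ⟨v, hv, rfl⟩, rfl⟩
      exact ⟨_, 𝒞.add_mem hz hv, hadd v⟩
    · rintro ⟨v, hv, rfl⟩
      refine ⟨_, ⟨v - (a • x - w), 𝒞.sub_mem hv hz, rfl⟩, ?_⟩
      simp only [← hadd]
      rw [add_sub_cancel]
  have h' : (fun c => a • Gray p α β x + c) '' (Gray p α β '' (𝒞 : Set _))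
      = Gray p α β '' (𝒞 : Set _) := h
  change (fun c => Gray p α β (a • x) + c) '' (Gray p α β '' (𝒞 : Set _))
      = Gray p α β '' (𝒞 : Set _)
  rw [hax]
  conv_rhs => rw [← hset, ← h', Set.image_image]
  simp only [add_assoc]
end

section
/- Let p be an odd prime, α, β : ℕ, 𝒞 an additive subgroup of (Fin α → ZMod p) × (Fin β → ZMod (p²)), and C = Φ '' 𝒞. Then K(C) is the carrier of a ZMod p-submodule of (Fin α → ZMod p) × (Fin β → Fin p → ZMod p) contained in C, and its Gray preimage 𝒦(𝒞) = {u ∈ 𝒞 : Φ(u) ∈ K(C)} is an additive subgroup of (Fin α → ZMod p) × (Fin β → ZMod (p²)) contained in 𝒞 (i.e. the kernel is a Z_pZ_{p²}-linear subcode of C). -/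
theorem aux_gray_nat (p n : ℕ) (i : Fin p) :
    gray p (n : ZMod (p ^ 2)) i = ((n / p : ℕ) : ZMod p) + (n : ZMod p) * ((i : ℕ) : ZMod p) := by
  unfold gray
  rw [ZMod.val_natCast, pow_two, Nat.mod_mul_right_div_self, Nat.mod_mul_right_mod]
  simp

theorem aux_gray_shift (p : ℕ) (hp : p.Prime) (a : ZMod (p ^ 2)) (k : ℕ) (i : Fin p) :
    gray p (a + (p : ZMod (p ^ 2)) * (k : ZMod (p ^ 2))) i = gray p a i + (k : ZMod p) := by
  have : NeZero (p ^ 2) := ⟨pow_ne_zero 2 hp.ne_zero⟩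
  obtain ⟨n, rfl⟩ : ∃ n : ℕ, (n : ZMod (p ^ 2)) = a := ⟨a.val, ZMod.natCast_zmod_val a⟩
  rw [← Nat.cast_mul, ← Nat.cast_add, aux_gray_nat, aux_gray_nat, Nat.add_mul_div_left _ _ hp.pos]
  push_cast
  simp
  ring

/-- the carry of the low digits -/
def auxCarry (p : ℕ) (a b : ZMod (p ^ 2)) : ℕ := (a.val % p + b.val % p) / p

theorem aux_gray_add (p : ℕ) (hp : p.Prime) (a b : ZMod (p ^ 2)) (i : Fin p) :
    gray p a i + gray p b i =
      gray p (a + b - (p : ZMod (p ^ 2)) * (auxCarry p a b : ZMod (p ^ 2))) i := by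
  have : NeZero (p ^ 2) := ⟨pow_ne_zero 2 hp.ne_zero⟩
  have h1 := aux_gray_shift p hp
    (a + b - (p : ZMod (p ^ 2)) * (auxCarry p a b : ZMod (p ^ 2))) (auxCarry p a b) i
  rw [sub_add_cancel] at h1
  have h2 : gray p (a + b) i = gray p a i + gray p b i + (auxCarry p a b : ZMod p) := by
    have hab : a + b = ((a.val + b.val : ℕ) : ZMod (p ^ 2)) := by
      push_cast
      rw [ZMod.natCast_zmod_val, ZMod.natCast_zmod_val]
    have hd : (a.val + b.val) / p = a.val / p + b.val / p + auxCarry p a b := by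
      unfold auxCarry
      have e : a.val + b.val = (a.val % p + b.val % p) + p * (a.val / p + b.val / p) := by
        have := Nat.mod_add_div a.val p
        have := Nat.mod_add_div b.val p
        rw [mul_add]; omega
      conv_lhs => rw [e]
      rw [Nat.add_mul_div_left _ _ hp.pos]; ring
    rw [hab, aux_gray_nat, hd]
    unfold gray
    push_cast
    simp only [ZMod.natCast_mod]
    ring
  rw [h2] at h1
  exact add_right_cancel h1

theorem aux_gray_inj (p : ℕ) (hp : p.Prime) : Function.Injective (gray p) := by
  have : NeZero (p ^ 2) := ⟨pow_ne_zero 2 hp.ne_zero⟩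
  intro a b h
  have h0 := congrFun h ⟨0, hp.pos⟩
  have h1 := congrFun h ⟨1, hp.one_lt⟩
  simp only [gray, Nat.cast_zero, mul_zero, add_zero, Nat.cast_one, mul_one] at h0 h1
  rw [h0] at h1
  have h1 := add_left_cancel h1
  rw [ZMod.natCast_eq_natCast_iff'] at h0 h1
  have ha : a.val / p < p := Nat.div_lt_of_lt_mul ((ZMod.val_lt a).trans_eq (pow_two p))
  have hb : b.val / p < p := Nat.div_lt_of_lt_mul ((ZMod.val_lt b).trans_eq (pow_two p))
  rw [Nat.mod_eq_of_lt ha, Nat.mod_eq_of_lt hb] at h0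
  rw [Nat.mod_mod, Nat.mod_mod] at h1
  apply ZMod.val_injective
  rw [← Nat.mod_add_div a.val p, ← Nat.mod_add_div b.val p, h0, h1]

theorem aux_carry_shift (p : ℕ) (hp : p.Prime) (a b : ZMod (p ^ 2)) (k : ℕ) :
    auxCarry p (a + (p : ZMod (p ^ 2)) * (k : ZMod (p ^ 2))) b = auxCarry p a b := by
  have : NeZero (p ^ 2) := ⟨pow_ne_zero 2 hp.ne_zero⟩
  obtain ⟨n, rfl⟩ : ∃ n : ℕ, (n : ZMod (p ^ 2)) = a := ⟨a.val, ZMod.natCast_zmod_val a⟩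
  unfold auxCarry
  rw [← Nat.cast_mul, ← Nat.cast_add, ZMod.val_natCast, ZMod.val_natCast,
    Nat.mod_mod_of_dvd _ (dvd_pow_self p two_ne_zero),
    Nat.mod_mod_of_dvd _ (dvd_pow_self p two_ne_zero), Nat.add_mul_mod_self_left]

/-- the carry vector, multiplied by `p` -/
def auxT (p α β : ℕ) (u v : (Fin α → ZMod p) × (Fin β → ZMod (p ^ 2))) :
    (Fin α → ZMod p) × (Fin β → ZMod (p ^ 2)) :=
  (0, fun j => (p : ZMod (p ^ 2)) * (auxCarry p (u.2 j) (v.2 j) : ZMod (p ^ 2)))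

theorem aux_Gray_add (p : ℕ) (hp : p.Prime) (α β : ℕ)
    (u v : (Fin α → ZMod p) × (Fin β → ZMod (p ^ 2))) :
    Gray p α β u + Gray p α β v = Gray p α β (u + v - auxT p α β u v) := by
  refine Prod.ext ?_ ?_
  · simp [Gray, auxT]
  · funext j i
    exact aux_gray_add p hp (u.2 j) (v.2 j) i

theorem aux_Gray_inj (p : ℕ) (hp : p.Prime) (α β : ℕ) : Function.Injective (Gray p α β) := by
  intro u v h
  have h1 : (Gray p α β u).1 = (Gray p α β v).1 := by rw [h]
  have h2 : (Gray p α β u).2 = (Gray p α β v).2 := by rw [h]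
  refine Prod.ext h1 ?_
  funext j
  exact aux_gray_inj p hp (congrFun h2 j)

theorem aux_T_shift (p : ℕ) (hp : p.Prime) (α β : ℕ)
    (u v a b : (Fin α → ZMod p) × (Fin β → ZMod (p ^ 2))) :
    auxT p α β (u + auxT p α β a b) v = auxT p α β u v := by
  refine Prod.ext rfl ?_
  funext j
  simp only [auxT, Prod.snd_add, Pi.add_apply, aux_carry_shift p hp]

theorem aux_mem_kernel {V : Type*} [AddCommGroup V] [Finite V] (C : Set V) (x : V) :
    x ∈ kernelSet C ↔ ∀ c ∈ C, x + c ∈ C := by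
  constructor
  · intro h c hc
    have h : (fun c => x + c) '' C = C := h
    rw [← h]
    exact ⟨c, hc, rfl⟩
  · intro h
    change (fun c => x + c) '' C = C
    apply Set.eq_of_subset_of_ncard_le
    · rintro _ ⟨c, hc, rfl⟩
      exact h c hc
    · rw [Set.ncard_image_of_injective _ (add_right_injective x)]
    · exact Set.toFinite C

theorem aux_kernel_add {V : Type*} [AddCommGroup V] [Finite V] (C : Set V) {x y : V}
    (hx : x ∈ kernelSet C) (hy : y ∈ kernelSet C) : x + y ∈ kernelSet C := by
  rw [aux_mem_kernel] at *
  intro c hc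
  rw [add_assoc]
  exact hx _ (hy _ hc)

theorem aux_finite_subgroup {V : Type*} [AddCommGroup V] [Finite V] (K : Set V)
    (h0 : (0 : V) ∈ K) (hadd : ∀ x ∈ K, ∀ y ∈ K, x + y ∈ K) :
    ∃ G : AddSubgroup V, (G : Set V) = K := by
  have hn : ∀ x ∈ K, ∀ n : ℕ, n • x ∈ K := by
    intro x hx n
    induction n with
    | zero => simpa using h0
    | succ n ih => rw [succ_nsmul]; exact hadd _ ih _ hx
  refine ⟨{ carrier := K, zero_mem' := h0, add_mem' := fun {a b} ha hb => hadd a ha b hb,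
            neg_mem' := ?_ }, rfl⟩
  intro x hx
  have h := hn x hx (addOrderOf x - 1)
  have hpos := addOrderOf_pos x
  have e : (addOrderOf x - 1) • x = -x := by
    rw [eq_neg_iff_add_eq_zero, ← succ_nsmul, Nat.sub_add_cancel hpos, addOrderOf_nsmul_eq_zero]
  rwa [e] at h

theorem aux_mem_iff (p : ℕ) (hp : p.Prime) (α β : ℕ)
    (𝒞 : AddSubgroup ((Fin α → ZMod p) × (Fin β → ZMod (p ^ 2))))
    (u : (Fin α → ZMod p) × (Fin β → ZMod (p ^ 2))) (hu : u ∈ 𝒞) :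
    Gray p α β u ∈ kernelSet (Gray p α β '' (𝒞 : Set _)) ↔ ∀ v ∈ 𝒞, auxT p α β u v ∈ 𝒞 := by
  have : NeZero p := ⟨hp.ne_zero⟩
  rw [aux_mem_kernel, Set.forall_mem_image]
  refine forall₂_congr fun v hv => ?_
  have hv : v ∈ 𝒞 := hv
  rw [aux_Gray_add p hp, (aux_Gray_inj p hp α β).mem_set_image, SetLike.mem_coe]
  constructor
  · intro h
    have := 𝒞.sub_mem (𝒞.add_mem hu hv) h
    rwa [sub_sub_cancel] at this
  · exact fun h => 𝒞.sub_mem (𝒞.add_mem hu hv) h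

/-- The kernel `K(C)` of `C = Φ '' 𝒞` is the carrier of a `ZMod p`-submodule contained
in `C`, and its Gray preimage `𝒦(𝒞) = {u ∈ 𝒞 : Φ(u) ∈ K(C)}` is an additive subgroup
contained in `𝒞`. -/
theorem kernel_is_subcode (p : ℕ) (hp : p.Prime) (hodd : Odd p) (α β : ℕ)
    (𝒞 : AddSubgroup ((Fin α → ZMod p) × (Fin β → ZMod (p ^ 2)))) :
    (∃ S : Submodule (ZMod p) ((Fin α → ZMod p) × (Fin β → Fin p → ZMod p)),
        (S : Set ((Fin α → ZMod p) × (Fin β → Fin p → ZMod p))) =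
          kernelSet (Gray p α β '' (𝒞 : Set ((Fin α → ZMod p) × (Fin β → ZMod (p ^ 2)))))) ∧
      kernelSet (Gray p α β '' (𝒞 : Set ((Fin α → ZMod p) × (Fin β → ZMod (p ^ 2))))) ⊆
        Gray p α β '' (𝒞 : Set ((Fin α → ZMod p) × (Fin β → ZMod (p ^ 2)))) ∧
      (∃ G : AddSubgroup ((Fin α → ZMod p) × (Fin β → ZMod (p ^ 2))),
        (G : Set ((Fin α → ZMod p) × (Fin β → ZMod (p ^ 2)))) =
          {u | u ∈ 𝒞 ∧ Gray p α β u ∈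
            kernelSet (Gray p α β '' (𝒞 : Set ((Fin α → ZMod p) × (Fin β → ZMod (p ^ 2)))))}) ∧
      {u | u ∈ 𝒞 ∧ Gray p α β u ∈
          kernelSet (Gray p α β '' (𝒞 : Set ((Fin α → ZMod p) × (Fin β → ZMod (p ^ 2)))))} ⊆
        (𝒞 : Set ((Fin α → ZMod p) × (Fin β → ZMod (p ^ 2)))) := by
  have : NeZero p := ⟨hp.ne_zero⟩
  have : NeZero (p ^ 2) := ⟨pow_ne_zero 2 hp.ne_zero⟩
  have hG0 : Gray p α β 0 = 0 := by
    refine Prod.ext rfl ?_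
    funext j i
    simp [Gray, gray]
  refine ⟨?_, ?_, ?_, fun u hu => hu.1⟩
  · obtain ⟨G, hG⟩ := aux_finite_subgroup
      (kernelSet (Gray p α β '' (𝒞 : Set ((Fin α → ZMod p) × (Fin β → ZMod (p ^ 2))))))
      (by rw [aux_mem_kernel]; intro c hc; rwa [zero_add])
      (fun x hx y hy => aux_kernel_add _ hx hy)
    exact ⟨AddSubgroup.toZModSubmodule p G, hG⟩
  · intro x hx
    rw [aux_mem_kernel] at hx
    have := hx 0 ⟨0, 𝒞.zero_mem, hG0⟩
    rwa [add_zero] at this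
  · apply aux_finite_subgroup
    · refine ⟨𝒞.zero_mem, ?_⟩
      rw [hG0, aux_mem_kernel]
      intro c hc
      rwa [zero_add]
    · rintro u ⟨hu, hu'⟩ w ⟨hw, hw'⟩
      refine ⟨𝒞.add_mem hu hw, ?_⟩
      have hs := aux_kernel_add _ hu' hw'
      have hT := (aux_mem_iff p hp α β 𝒞 u hu).1 hu' w hw
      rw [aux_Gray_add p hp,
        aux_mem_iff p hp α β 𝒞 _ (𝒞.sub_mem (𝒞.add_mem hu hw) hT)] at hs
      rw [aux_mem_iff p hp α β 𝒞 _ (𝒞.add_mem hu hw)]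
      intro v hv
      have h := hs v hv
      rwa [← aux_T_shift p hp α β _ v u w, sub_add_cancel] at h
end

section
/- Let p be an odd prime, α, β, γ, δ : ℕ, and let 𝒞 be an additive subgroup of (Fin α → ZMod p) × (Fin β → ZMod (p²)) admitting an additive group isomorphism 𝒞 ≃+ (Fin γ → ZMod p) × (Fin δ → ZMod (p²)). Let C = Φ '' 𝒞. Then there exists a natural number k̄ with 0 ≤ k̄ ≤ δ such that Nat.card (K(C)) = p^(γ + 2δ − k̄); that is, the dimension of the kernel of C equals γ + 2δ − k̄ for some k̄ ∈ {0, 1, …, δ}. -/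
theorem gray_add_aux_s12 (p : ℕ) (hp : p.Prime) (s t : ZMod (p ^ 2)) (hs : p • s = 0) :
    gray p (s + t) = gray p s + gray p t := by
  have : NeZero p := ⟨hp.ne_zero⟩
  have : NeZero (p ^ 2) := ⟨pow_ne_zero 2 hp.ne_zero⟩
  have h1 : ((p * s.val : ℕ) : ZMod (p ^ 2)) = 0 := by
    rw [Nat.cast_mul, ZMod.natCast_zmod_val, ← nsmul_eq_mul, hs]
  rw [ZMod.natCast_eq_zero_iff] at h1
  obtain ⟨k, hk⟩ := Nat.dvd_of_mul_dvd_mul_left hp.pos ((sq p).symm.dvd.trans h1)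
  have hd : (s + t).val / p = (k + t.val / p) % p := by
    rw [ZMod.val_add, hk]
    generalize t.val = m
    rw [sq, Nat.mod_mul_right_div_self, Nat.mul_add_div hp.pos]
  have hm : (s + t).val % p = t.val % p := by
    rw [ZMod.val_add, hk]
    generalize t.val = m
    rw [sq, Nat.mod_mul_right_mod, Nat.mul_add_mod]
  have hd' : s.val / p = k := by rw [hk, Nat.mul_div_cancel_left _ hp.pos]
  have hm' : s.val % p = 0 := by rw [hk, Nat.mul_mod_right]
  funext i
  simp only [gray, Pi.add_apply, hd, hm, hd', hm', ZMod.natCast_mod]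
  push_cast
  ring

theorem Gray_add_aux (p α β : ℕ) (hp : p.Prime)
    (s t : (Fin α → ZMod p) × (Fin β → ZMod (p ^ 2))) (hs : p • s = 0) :
    Gray p α β (s + t) = Gray p α β s + Gray p α β t := by
  refine Prod.ext rfl ?_
  funext j
  exact gray_add_aux_s12 p hp _ _ (congrFun (congrArg Prod.snd hs) j)

theorem gray_inj_aux (p : ℕ) (hp : p.Prime) (s : ZMod (p ^ 2)) (hs : p • s = 0)
    (h : gray p s = 0) : s = 0 := by
  have : NeZero p := ⟨hp.ne_zero⟩
  have : NeZero (p ^ 2) := ⟨pow_ne_zero 2 hp.ne_zero⟩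
  have h1 : ((p * s.val : ℕ) : ZMod (p ^ 2)) = 0 := by
    rw [Nat.cast_mul, ZMod.natCast_zmod_val, ← nsmul_eq_mul, hs]
  rw [ZMod.natCast_eq_zero_iff] at h1
  obtain ⟨k, hk⟩ := Nat.dvd_of_mul_dvd_mul_left hp.pos ((sq p).symm.dvd.trans h1)
  have h0 := congrFun h ⟨0, hp.pos⟩
  simp only [gray, hk, Nat.mul_div_cancel_left _ hp.pos, Nat.mul_mod_right, Nat.cast_zero,
    zero_mul, add_zero, Pi.zero_apply] at h0
  rw [ZMod.natCast_eq_zero_iff] at h0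
  have h2 : p ^ 2 ∣ s.val := by
    rw [hk, sq]; exact Nat.mul_dvd_mul_left p h0
  rw [← ZMod.natCast_zmod_val s, ZMod.natCast_eq_zero_iff]
  exact h2

theorem Gray_inj_aux (p α β : ℕ) (hp : p.Prime)
    (s t : (Fin α → ZMod p) × (Fin β → ZMod (p ^ 2))) (hs : p • s = 0) (ht : p • t = 0)
    (h : Gray p α β s = Gray p α β t) : s = t := by
  have hst : p • (s - t) = 0 := by rw [smul_sub, hs, ht, sub_zero]
  have h1 := Gray_add_aux p α β hp (s - t) t hst
  rw [sub_add_cancel, h] at h1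
  have h2 : Gray p α β (s - t) = 0 := by simpa using h1
  rw [← sub_eq_zero]
  refine Prod.ext (show (Gray p α β (s - t)).1 = 0 by rw [h2]; rfl) ?_
  funext j
  exact gray_inj_aux p hp _ (congrFun (congrArg Prod.snd hst) j)
    (congrFun (congrArg Prod.snd h2) j)

/-- The kernel as an additive subgroup. -/
def kernelSubgroup {V : Type*} [AddCommGroup V] (C : Set V) : AddSubgroup V where
  carrier := kernelSet C
  zero_mem' := by simp [kernelSet]
  add_mem' := by
    intro a b ha hb
    simp only [kernelSet, Set.mem_ofPred_eq] at *
    conv_rhs => rw [← ha, ← hb, Set.image_image]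
    simp only [add_assoc]
  neg_mem' := by
    intro a ha
    simp only [kernelSet, Set.mem_ofPred_eq] at *
    conv_lhs => rw [← ha, Set.image_image]
    simp

/-- The kernel dimension of `C` equals `γ + 2δ − k̄` for some `k̄ ∈ {0, …, δ}`. -/
theorem kernel_card_eq (p : ℕ) (hp : p.Prime) (hodd : Odd p) (α β γ δ : ℕ)
    (𝒞 : AddSubgroup ((Fin α → ZMod p) × (Fin β → ZMod (p ^ 2))))
    (e : 𝒞 ≃+ (Fin γ → ZMod p) × (Fin δ → ZMod (p ^ 2))) :
    ∃ kbar : ℕ, kbar ≤ δ ∧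
      Nat.card
          (kernelSet (Gray p α β '' (𝒞 : Set ((Fin α → ZMod p) × (Fin β → ZMod (p ^ 2)))))) =
        p ^ (γ + 2 * δ - kbar) := by
  have : Fact p.Prime := ⟨hp⟩
  have : NeZero p := ⟨hp.ne_zero⟩
  have : NeZero (p ^ 2) := ⟨pow_ne_zero 2 hp.ne_zero⟩
  set C := Gray p α β '' (𝒞 : Set ((Fin α → ZMod p) × (Fin β → ZMod (p ^ 2)))) with hC
  -- the cardinality is a power of p
  have hpow : ∃ k, Nat.card (kernelSet C) = p ^ k := by
    have hdvd : Nat.card (kernelSubgroup C) ∣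
        Nat.card ((Fin α → ZMod p) × (Fin β → Fin p → ZMod p)) :=
      AddSubgroup.card_addSubgroup_dvd_card _
    have hV : Nat.card ((Fin α → ZMod p) × (Fin β → Fin p → ZMod p)) = p ^ (α + p * β) := by
      simp [Nat.card_prod, Nat.card_fun, pow_add, pow_mul]
    rw [hV, Nat.dvd_prime_pow hp] at hdvd
    obtain ⟨k, -, hk⟩ := hdvd
    exact ⟨k, hk⟩
  obtain ⟨k, hk⟩ := hpow
  -- upper bound
  have hub : Nat.card (kernelSet C) ≤ p ^ (γ + 2 * δ) := by
    have hsub : kernelSet C ⊆ C := by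
      intro x hx
      have h0 : (0 : (Fin α → ZMod p) × (Fin β → Fin p → ZMod p)) ∈ C := by
        refine ⟨0, 𝒞.zero_mem, ?_⟩
        refine Prod.ext rfl ?_
        funext j i
        simp [Gray, gray]
      have hx' : (fun c => x + c) '' C = C := hx
      rw [← hx']
      exact ⟨0, h0, by simp⟩
    calc Nat.card (kernelSet C) ≤ Nat.card C := Nat.card_mono (Set.toFinite _) hsub
      _ ≤ Nat.card 𝒞 := Nat.card_image_le (Set.toFinite _)
      _ = Nat.card ((Fin γ → ZMod p) × (Fin δ → ZMod (p ^ 2))) := Nat.card_congr e.toEquiv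
      _ = p ^ (γ + 2 * δ) := by
        simp [Nat.card_prod, Nat.card_fun, pow_add, pow_mul]
  -- lower bound
  have hlb : p ^ (γ + δ) ≤ Nat.card (kernelSet C) := by
    let g : (Fin γ → ZMod p) × (Fin δ → ZMod p) → (Fin γ → ZMod p) × (Fin δ → ZMod (p ^ 2)) :=
      fun u => (u.1, fun j => ((p * (u.2 j).val : ℕ) : ZMod (p ^ 2)))
    have hg : ∀ u, p • g u = 0 := by
      intro u
      refine Prod.ext ?_ ?_
      · funext j
        simp [g]
      · funext j
        change p • ((p * (u.2 j).val : ℕ) : ZMod (p ^ 2)) = 0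
        rw [nsmul_eq_mul, ← Nat.cast_mul, ZMod.natCast_eq_zero_iff, ← mul_assoc, sq]
        exact Dvd.intro _ rfl
    have hginj : Function.Injective g := by
      intro u v h
      refine Prod.ext (show (g u).1 = (g v).1 by rw [h]) ?_
      funext j
      have h2 : ((p * (u.2 j).val : ℕ) : ZMod (p ^ 2)) = ((p * (v.2 j).val : ℕ) : ZMod (p ^ 2)) :=
        congrFun (congrArg Prod.snd h) j
      rw [ZMod.natCast_eq_natCast_iff, sq] at h2
      have h3 := Nat.ModEq.mul_left_cancel' hp.ne_zero h2
      rw [← ZMod.natCast_eq_natCast_iff, ZMod.natCast_zmod_val, ZMod.natCast_zmod_val] at h3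
      exact h3
    have ht : ∀ u, p • ((e.symm (g u) : 𝒞) : (Fin α → ZMod p) × (Fin β → ZMod (p ^ 2))) = 0 := by
      intro u
      rw [← AddSubgroup.coe_nsmul, ← map_nsmul, hg, map_zero, AddSubgroup.coe_zero]
    let F : (Fin γ → ZMod p) × (Fin δ → ZMod p) → kernelSet C := fun u =>
      ⟨Gray p α β (e.symm (g u) : 𝒞), by
        apply Set.Subset.antisymm
        · rintro _ ⟨_, ⟨c, hc, rfl⟩, rfl⟩
          exact ⟨_, 𝒞.add_mem (e.symm (g u)).2 hc, Gray_add_aux p α β hp _ _ (ht u)⟩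
        · rintro _ ⟨c, hc, rfl⟩
          refine ⟨_, ⟨_, 𝒞.sub_mem hc (e.symm (g u)).2, rfl⟩, ?_⟩
          change _ + _ = _
          rw [← Gray_add_aux p α β hp _ _ (ht u), add_sub_cancel]⟩
    have hF : Function.Injective F := by
      intro u v h
      have h1 := Gray_inj_aux p α β hp _ _ (ht u) (ht v) (congrArg Subtype.val h)
      exact hginj (e.symm.injective (Subtype.ext h1))
    calc p ^ (γ + δ) = Nat.card ((Fin γ → ZMod p) × (Fin δ → ZMod p)) := by
          simp [Nat.card_prod, Nat.card_fun, pow_add]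
      _ ≤ Nat.card (kernelSet C) := Nat.card_le_card_of_injective F hF
  rw [hk] at hub hlb
  have h1 := (Nat.pow_le_pow_iff_right hp.one_lt).1 hub
  have h2 := (Nat.pow_le_pow_iff_right hp.one_lt).1 hlb
  refine ⟨γ + 2 * δ - k, by omega, ?_⟩
  rw [hk]
  congr 1
  omega
end

section
/- Let α, β : ℕ and let 𝒞 be an additive subgroup of (Fin α → ZMod 3) × (Fin β → ZMod 9). Then the linear span of the Gray image C = Φ '' 𝒞 is again a Z₃Z₉-linear code: there exists an additive subgroup 𝒮 of (Fin α → ZMod 3) × (Fin β → ZMod 9) with 𝒞 ⊆ 𝒮 such that Φ '' 𝒮 equals the carrier of Submodule.span (ZMod 3) C. -/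
/-- Reduction mod 3. -/
def red3 (a : ZMod 9) : ZMod 3 := (a.val : ZMod 3)

theorem red3_add (a b : ZMod 9) : red3 (a + b) = red3 a + red3 b := by
  revert a b; decide

theorem gray3_diff (a : ZMod 9) : gray3 a 1 - gray3 a 0 = red3 a := by
  revert a; decide

theorem gray3_add (a b : ZMod 9) (i : Fin 3) : gray3 (a + b) i = gray3 a i + gray3 b i +
    (-(red3 a * red3 b) - red3 a * red3 b * (red3 a + red3 b)) := by
  revert a b i; decide

theorem gray3_neg (a : ZMod 9) (i : Fin 3) :
    gray3 (-a) i = -gray3 a i - red3 a * red3 a := by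
  revert a i; decide

theorem gray3_surj (x : Fin 3 → ZMod 3) (h : x 2 = 2 * x 1 - x 0) : ∃ a, gray3 a = x := by
  revert x; decide

theorem gray3_two (a : ZMod 9) : gray3 a 2 = 2 * gray3 a 1 - gray3 a 0 := by
  revert a; decide

theorem span_props (α β : ℕ) (𝒞 : AddSubgroup ((Fin α → ZMod 3) × (Fin β → ZMod 9)))
    (x : (Fin α → ZMod 3) × (Fin β → Fin 3 → ZMod 3))
    (hx : x ∈ Submodule.span (ZMod 3) (Gray3 α β '' (𝒞 : Set _))) :
    (∃ w ∈ 𝒞, ∀ j, x.2 j 1 - x.2 j 0 = red3 (w.2 j)) ∧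
      ∀ j, x.2 j 2 = 2 * x.2 j 1 - x.2 j 0 := by
  have hadd : ∀ x y : (Fin α → ZMod 3) × (Fin β → Fin 3 → ZMod 3),
      ((∃ w ∈ 𝒞, ∀ j, x.2 j 1 - x.2 j 0 = red3 (w.2 j)) ∧
        ∀ j, x.2 j 2 = 2 * x.2 j 1 - x.2 j 0) →
      ((∃ w ∈ 𝒞, ∀ j, y.2 j 1 - y.2 j 0 = red3 (w.2 j)) ∧
        ∀ j, y.2 j 2 = 2 * y.2 j 1 - y.2 j 0) →
      ((∃ w ∈ 𝒞, ∀ j, (x + y).2 j 1 - (x + y).2 j 0 = red3 (w.2 j)) ∧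
        ∀ j, (x + y).2 j 2 = 2 * (x + y).2 j 1 - (x + y).2 j 0) := by
    rintro x y ⟨⟨u, hu, hu'⟩, h⟩ ⟨⟨v, hv, hv'⟩, k⟩
    refine ⟨⟨u + v, 𝒞.add_mem hu hv, fun j => ?_⟩, fun j => ?_⟩
    · simp only [Prod.snd_add, Pi.add_apply, red3_add, ← hu', ← hv']; ring
    · simp only [Prod.snd_add, Pi.add_apply, h, k]; ring
  have hzero : (∃ w ∈ 𝒞, ∀ j, (0 : (Fin α → ZMod 3) × (Fin β → Fin 3 → ZMod 3)).2 j 1 -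
      (0 : (Fin α → ZMod 3) × (Fin β → Fin 3 → ZMod 3)).2 j 0 = red3 (w.2 j)) ∧
      ∀ j, (0 : (Fin α → ZMod 3) × (Fin β → Fin 3 → ZMod 3)).2 j 2 =
        2 * (0 : (Fin α → ZMod 3) × (Fin β → Fin 3 → ZMod 3)).2 j 1 -
          (0 : (Fin α → ZMod 3) × (Fin β → Fin 3 → ZMod 3)).2 j 0 :=
    ⟨⟨0, 𝒞.zero_mem, fun j => by simp [red3]⟩, fun j => by simp⟩
  induction hx using Submodule.span_induction with
  | mem x h =>
    obtain ⟨w, hw, rfl⟩ := h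
    exact ⟨⟨w, hw, fun j => gray3_diff _⟩, fun j => gray3_two _⟩
  | zero => exact hzero
  | add x y _ _ hx hy => exact hadd x y hx hy
  | smul a x _ hx =>
    have ha : a = 0 ∨ a = 1 ∨ a = 1 + 1 := by revert a; decide
    rcases ha with rfl | rfl | rfl
    · rw [zero_smul]; exact hzero
    · rw [one_smul]; exact hx
    · rw [add_smul, one_smul]; exact hadd x x hx hx

/-- The linear span of a `Z₃Z₉`-linear code `C = Φ '' 𝒞` is again `Z₃Z₉`-linear. -/
theorem span_is_Z3Z9linear (α β : ℕ)
    (𝒞 : AddSubgroup ((Fin α → ZMod 3) × (Fin β → ZMod 9))) :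
    ∃ 𝒮 : AddSubgroup ((Fin α → ZMod 3) × (Fin β → ZMod 9)),
      (𝒞 : Set ((Fin α → ZMod 3) × (Fin β → ZMod 9))) ⊆
        (𝒮 : Set ((Fin α → ZMod 3) × (Fin β → ZMod 9))) ∧
      Gray3 α β '' (𝒮 : Set ((Fin α → ZMod 3) × (Fin β → ZMod 9))) =
        (Submodule.span (ZMod 3)
          (Gray3 α β '' (𝒞 : Set ((Fin α → ZMod 3) × (Fin β → ZMod 9)))) :
          Set ((Fin α → ZMod 3) × (Fin β → Fin 3 → ZMod 3))) := by
  have key : ∀ u : (Fin α → ZMod 3) × (Fin β → ZMod 9),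
      Gray3 α β u ∈ Submodule.span (ZMod 3) (Gray3 α β '' (𝒞 : Set _)) →
      ∃ w ∈ 𝒞, ∀ j, red3 (u.2 j) = red3 (w.2 j) := by
    intro u hu
    obtain ⟨⟨w, hw, h⟩, -⟩ := span_props α β 𝒞 _ hu
    exact ⟨w, hw, fun j => by rw [← h j]; exact (gray3_diff _).symm⟩
  have hsub : ∀ w ∈ 𝒞, Gray3 α β w ∈
      Submodule.span (ZMod 3) (Gray3 α β '' (𝒞 : Set _)) :=
    fun w hw => Submodule.subset_span ⟨w, hw, rfl⟩
  refine ⟨{ carrier := {u | Gray3 α β u ∈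
              Submodule.span (ZMod 3) (Gray3 α β '' (𝒞 : Set _))}
            zero_mem' := by rw [Set.mem_ofPred_eq]; exact hsub 0 𝒞.zero_mem
            add_mem' := ?_
            neg_mem' := ?_ }, hsub, ?_⟩
  · intro u v hu hv
    obtain ⟨a, ha, hau⟩ := key u hu
    obtain ⟨b, hb, hbv⟩ := key v hv
    have e : Gray3 α β (u + v) = Gray3 α β u + Gray3 α β v +
        (Gray3 α β (a + b) - Gray3 α β a - Gray3 α β b) := by
      refine Prod.ext ?_ ?_
      · simp [Gray3]
      · funext j i
        simp only [Gray3, Prod.snd_add, Prod.snd_sub, Pi.add_apply, Pi.sub_apply, gray3_add,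
          hau, hbv]
        ring
    rw [Set.mem_ofPred_eq, e]
    exact add_mem (add_mem hu hv)
      (sub_mem (sub_mem (hsub _ (𝒞.add_mem ha hb)) (hsub a ha)) (hsub b hb))
  · intro u hu
    obtain ⟨a, ha, hau⟩ := key u hu
    have e : Gray3 α β (-u) = -Gray3 α β u + (Gray3 α β (-a) + Gray3 α β a) := by
      refine Prod.ext ?_ ?_
      · simp [Gray3]
      · funext j i
        simp only [Gray3, Prod.snd_add, Prod.snd_neg, Pi.add_apply, Pi.neg_apply, gray3_neg,
          hau]
        ring
    rw [Set.mem_ofPred_eq, e]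
    exact add_mem (neg_mem hu) (add_mem (hsub _ (𝒞.neg_mem ha)) (hsub a ha))
  · apply Set.Subset.antisymm
    · rintro _ ⟨u, hu, rfl⟩
      exact hu
    · intro x hx
      obtain ⟨-, h⟩ := span_props α β 𝒞 x hx
      choose f hf using fun j => gray3_surj (x.2 j) (h j)
      have e : Gray3 α β (x.1, f) = x := Prod.ext rfl (funext hf)
      refine ⟨(x.1, f), ?_, e⟩
      change Gray3 α β (x.1, f) ∈ Submodule.span (ZMod 3) (Gray3 α β '' (𝒞 : Set _))
      rw [e]; exact hx
end

section
/- Let α, β, γ, δ, κ be natural numbers satisfying α + β > 0, 0 < γ + δ ≤ β + κ, and κ ≤ min(α, γ), and let r be a natural number. Then there exists an additive subgroup 𝒞 of (Fin α → ZMod 3) × (Fin β → ZMod 9) with 𝒞 ≃+ (Fin γ → ZMod 3) × (Fin δ → ZMod 9), with the ZMod 3-dimension of the projection onto the first α coordinates of the order-3 subcode {u ∈ 𝒞 : 3 • u = 0} equal to κ, and with Module.finrank (ZMod 3) (Submodule.span (ZMod 3) (Φ '' 𝒞)) = r, if and only if γ + 2δ ≤ r ≤ min(β + δ + κ, γ +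 δ + choose(δ+1, 2) + choose(δ+2, 3)). -/
/-- The parameter `κ`: the `ZMod 3`-dimension of the projection onto the first `α`
coordinates of the order-3 subcode of `𝒞`. -/
noncomputable def kappa3 (α β : ℕ)
    (𝒞 : AddSubgroup ((Fin α → ZMod 3) × (Fin β → ZMod 9))) : ℕ :=
  Module.finrank (ZMod 3)
    (Submodule.span (ZMod 3)
      (Prod.fst '' {u : (Fin α → ZMod 3) × (Fin β → ZMod 9) | u ∈ 𝒞 ∧ 3 • u = 0}))

/-- low ternary digit -/
def lo (θ : ZMod 9) : ZMod 3 := ((θ.val % 3 : ℕ) : ZMod 3)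
/-- high ternary digit -/
def hi (θ : ZMod 9) : ZMod 3 := ((θ.val / 3 : ℕ) : ZMod 3)

lemma lo_add : ∀ a b : ZMod 9, lo (a + b) = lo a + lo b := by decide
lemma hi_add : ∀ a b : ZMod 9, hi (a + b) = hi a + hi b +
    (2 * (lo a * lo b) - lo a * lo a * lo b - lo a * lo b * lo b) := by decide
lemma lo_neg : ∀ a : ZMod 9, lo (-a) = - lo a := by decide
lemma lohi_inj : ∀ a b : ZMod 9, lo a = lo b → hi a = hi b → a = b := by decide
lemma lo_tor : ∀ (c : ZMod 9), 3 • c = 0 → ∀ a : ZMod 3, lo (a.val • c) = 0 := by decide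
lemma hi_tor : ∀ (c : ZMod 9), 3 • c = 0 → ∀ a : ZMod 3, hi (a.val • c) = hi c * a := by decide
lemma cube3 : ∀ a : ZMod 3, a * a * a = a := by decide
lemma natcast_lo : ∀ a : ZMod 9, ((a.val : ℕ) : ZMod 3) = lo a := by decide

/-- parameter space -/
abbrev SS (γ δ : ℕ) := (Fin γ → ZMod 3) × (Fin δ → ZMod 9)
/-- function space -/
abbrev FS (γ δ : ℕ) := SS γ δ → ZMod 3

section helpers
variable {γ δ : ℕ}

/-- coordinate functions -/
def mu (j : Fin γ) : FS γ δ := fun s => s.1 j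
/-- low digit functions -/
def lam (i : Fin δ) : FS γ δ := fun s => lo (s.2 i)
/-- high digit functions -/
def lam2 (i : Fin δ) : FS γ δ := fun s => hi (s.2 i)
/-- monomials -/
def mono (γ δ k : ℕ) (m : Sym (Fin δ) k) : FS γ δ := (m.1.map lam).prod

/-- linear forms -/
def Lsp (γ δ : ℕ) : Submodule (ZMod 3) (FS γ δ) := Submodule.span _ (Set.range lam)

/-- the full family -/
def fam (γ δ : ℕ) : (Fin γ ⊕ Fin δ) ⊕ (Sym (Fin δ) 2 ⊕ Sym (Fin δ) 3) → FS γ δ :=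
  Sum.elim (Sum.elim mu lam2) (Sum.elim (mono γ δ 2) (mono γ δ 3))

/-- span of full family -/
def Psp (γ δ : ℕ) : Submodule (ZMod 3) (FS γ δ) := Submodule.span _ (Set.range (fam γ δ))

lemma card_fam (γ δ : ℕ) : Fintype.card ((Fin γ ⊕ Fin δ) ⊕ (Sym (Fin δ) 2 ⊕ Sym (Fin δ) 3))
    = γ + δ + Nat.choose (δ + 1) 2 + Nat.choose (δ + 2) 3 := by
  simp only [Fintype.card_sum, Sym.card_sym_eq_choose, Fintype.card_fin]
  simp only [show δ + 2 - 1 = δ + 1 by omega, show δ + 3 - 1 = δ + 2 by omega]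
  omega

lemma finrank_Psp_le (γ δ : ℕ) : Module.finrank (ZMod 3) (Psp γ δ)
    ≤ γ + δ + Nat.choose (δ + 1) 2 + Nat.choose (δ + 2) 3 := by
  rw [← card_fam]; exact finrank_range_le_card _

lemma mu_mem (j : Fin γ) : (mu j : FS γ δ) ∈ Psp γ δ :=
  Submodule.subset_span ⟨Sum.inl (Sum.inl j), rfl⟩
lemma lam2_mem (j : Fin δ) : (lam2 j : FS γ δ) ∈ Psp γ δ :=
  Submodule.subset_span ⟨Sum.inl (Sum.inr j), rfl⟩
lemma lam_mem (j : Fin δ) : (lam j : FS γ δ) ∈ Lsp γ δ :=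
  Submodule.subset_span ⟨j, rfl⟩

lemma mul2_mem {u v : FS γ δ} (hu : u ∈ Lsp γ δ) (hv : v ∈ Lsp γ δ) : u * v ∈ Psp γ δ := by
  have h := Submodule.mul_mem_mul hu hv
  rw [Lsp, Submodule.span_mul_span] at h
  refine Submodule.span_mono ?_ h
  rintro _ ⟨_, ⟨i, rfl⟩, _, ⟨j, rfl⟩, rfl⟩
  refine ⟨Sum.inr (Sum.inl ⟨{i, j}, by simp⟩), ?_⟩
  change (Multiset.map lam {i, j}).prod = _
  simp

lemma mul3_mem {u v w : FS γ δ} (hu : u ∈ Lsp γ δ) (hv : v ∈ Lsp γ δ) (hw : w ∈ Lsp γ δ) :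
    u * v * w ∈ Psp γ δ := by
  have h := Submodule.mul_mem_mul (Submodule.mul_mem_mul hu hv) hw
  rw [Lsp, Submodule.span_mul_span, Submodule.span_mul_span] at h
  refine Submodule.span_mono ?_ h
  rintro _ ⟨_, ⟨_, ⟨i, rfl⟩, _, ⟨j, rfl⟩, rfl⟩, _, ⟨k, rfl⟩, rfl⟩
  refine ⟨Sum.inr (Sum.inr ⟨{i, j, k}, by simp⟩), ?_⟩
  change (Multiset.map lam {i, j, k}).prod = _
  simp [mul_assoc]

lemma Lsp_le : Lsp γ δ ≤ Psp γ δ := by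
  refine Submodule.span_le.2 ?_
  rintro _ ⟨i, rfl⟩
  have := mul3_mem (lam_mem (γ := γ) i) (lam_mem i) (lam_mem i)
  have h : (lam i : FS γ δ) * lam i * lam i = lam i := funext fun s => cube3 _
  rw [h] at this
  exact this

/-- good functions -/
def Bset (γ δ : ℕ) : AddSubmonoid (SS γ δ → ZMod 9) where
  carrier := {f | (fun s => lo (f s)) ∈ Lsp γ δ ∧ (fun s => hi (f s)) ∈ Psp γ δ}
  zero_mem' := by
    refine ⟨?_, ?_⟩
    · convert (Lsp γ δ).zero_mem using 1
      funext s
      exact (by decide : lo 0 = 0)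
    · convert (Psp γ δ).zero_mem using 1
      funext s
      exact (by decide : hi 0 = 0)
  add_mem' := by
    rintro f g ⟨h1, h2⟩ ⟨h3, h4⟩
    refine ⟨?_, ?_⟩
    · convert add_mem h1 h3 using 1
      funext s
      exact lo_add _ _
    · convert add_mem (add_mem h2 h4) (sub_mem (sub_mem
        ((Psp γ δ).smul_mem 2 (mul2_mem h1 h3)) (mul3_mem h1 h1 h3)) (mul3_mem h1 h3 h3)) using 1
      funext s
      exact hi_add _ _

lemma hom_decomp {A : Type*} [AddCommGroup A] (g : SS γ δ →+ A) (s : SS γ δ) :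
    g s = ∑ j, (s.1 j).val • g (Pi.single j 1, 0) + ∑ i, (s.2 i).val • g (0, Pi.single i 1) := by
  simp only [← map_nsmul, ← map_sum, ← map_add]
  congr 1
  ext k
  · simp [-nsmul_eq_mul, Prod.fst_sum, Finset.sum_apply, Pi.single_apply, Pi.smul_apply]
  · simp [-nsmul_eq_mul, Prod.snd_sum, Finset.sum_apply, Pi.single_apply, Pi.smul_apply]

lemma hom_mem_Bset (g : SS γ δ →+ ZMod 9) : (g : SS γ δ → ZMod 9) ∈ Bset γ δ := by
  have : (g : SS γ δ → ZMod 9) = ∑ j, (fun s => (s.1 j).val • g (Pi.single j 1, 0))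
      + ∑ i, (g (0, Pi.single i 1)).val • (fun s : SS γ δ => s.2 i) := by
    funext s
    rw [hom_decomp g s]
    simp only [Pi.add_apply, Finset.sum_apply, Pi.smul_apply]
    simp [mul_comm]
  rw [this]
  refine add_mem (sum_mem fun j _ => ?_) (sum_mem fun i _ => nsmul_mem ?_ _)
  · have h3 : 3 • g (Pi.single j 1, 0) = 0 := by
      rw [← map_nsmul]
      convert map_zero g
      ext k
      · simp only [Prod.smul_fst, Pi.smul_apply, Prod.fst_zero, Pi.zero_apply]
        generalize (Pi.single j 1 : Fin γ → ZMod 3) k = x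
        exact (by decide : ∀ x : ZMod 3, 3 • x = 0) x
      · simp
    refine ⟨?_, ?_⟩
    · convert (Lsp γ δ).zero_mem using 1
      funext s
      exact lo_tor _ h3 _
    · convert (Psp γ δ).smul_mem (hi (g (Pi.single j 1, 0))) (mu_mem j) using 1
      funext s
      exact hi_tor _ h3 _
  · exact ⟨lam_mem i, lam2_mem i⟩

/-- the part depending on the torsion coordinates -/
def xpart (x : SS γ δ →+ ZMod 3) : FS γ δ := fun s => x (s.1, 0)

lemma x_sub_mem (x : SS γ δ →+ ZMod 3) : (x : FS γ δ) - xpart x ∈ Lsp γ δ := by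
  have : (x : FS γ δ) - xpart x = ∑ i, x (0, Pi.single i 1) • (lam i : FS γ δ) := by
    funext s
    simp only [Pi.sub_apply, xpart]
    rw [hom_decomp x s, hom_decomp x (s.1, 0)]
    simp [Finset.sum_apply, lam, ← natcast_lo, mul_comm]
  rw [this]
  exact sum_mem fun i _ => Submodule.smul_mem _ _ (lam_mem i)

lemma xpart_mem (x : SS γ δ →+ ZMod 3) : xpart x ∈ Submodule.span (ZMod 3) (Set.range (mu : Fin γ → FS γ δ)) := by
  have : xpart x = ∑ j, x (Pi.single j 1, 0) • (mu j : FS γ δ) := by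
    funext s
    simp only [xpart]
    rw [hom_decomp x (s.1, 0)]
    simp [Finset.sum_apply, mu, mul_comm]
  rw [this]
  exact sum_mem fun i _ => Submodule.smul_mem _ _ (Submodule.subset_span ⟨i, rfl⟩)

lemma span_mu_le : Submodule.span (ZMod 3) (Set.range (mu : Fin γ → FS γ δ)) ≤ Psp γ δ :=
  Submodule.span_le.2 (by rintro _ ⟨j, rfl⟩; exact mu_mem j)

lemma rowcol {S ι : Type*} [Fintype S] [Fintype ι] (M : S → ι → ZMod 3) :
    Module.finrank (ZMod 3) (Submodule.span (ZMod 3) (Set.range M)) =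
    Module.finrank (ZMod 3) (Submodule.span (ZMod 3) (Set.range (fun i s => M s i))) := by
  have h1 := Matrix.rank_eq_finrank_span_row (Matrix.of M)
  have h2 := Matrix.rank_eq_finrank_span_cols (Matrix.of M)
  exact h1.symm.trans h2

lemma card_le_span {V : Type*} [AddCommGroup V] [Module (ZMod 3) V] [Finite V]
    (A : Set V) (n : ℕ) (h : 3 ^ n ≤ Nat.card A) :
    n ≤ Module.finrank (ZMod 3) (Submodule.span (ZMod 3) A) := by
  have h1 : Nat.card (Submodule.span (ZMod 3) A) =
      3 ^ Module.finrank (ZMod 3) (Submodule.span (ZMod 3) A) := by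
    have := Module.natCard_eq_pow_finrank (K := ZMod 3) (V := Submodule.span (ZMod 3) A)
    simpa using this
  have h2 : Nat.card A ≤ Nat.card (Submodule.span (ZMod 3) A) :=
    Nat.card_mono (Set.toFinite _) Submodule.subset_span
  exact (Nat.pow_le_pow_iff_right (by norm_num)).1 (h.trans (h2.trans h1.le))

lemma card_SS (γ δ : ℕ) : Nat.card (SS γ δ) = 3 ^ (γ + 2 * δ) := by
  simp [Nat.card_eq_fintype_card, pow_add, pow_mul]

/-- column space -/
def CS {α β : ℕ} (ψ : SS γ δ →+ (Fin α → ZMod 3) × (Fin β → ZMod 9)) :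
    Submodule (ZMod 3) (FS γ δ) :=
  Submodule.span _ (Set.range fun i s => (ψ s).1 i) ⊔
  (Submodule.span _ (Set.range fun j s => hi ((ψ s).2 j)) ⊔
   Submodule.span _ (Set.range fun j s => lo ((ψ s).2 j)))

/-- linear model of Gray map -/
def Lmap (α β : ℕ) : (Fin α ⊕ (Fin β ⊕ Fin β) → ZMod 3) →ₗ[ZMod 3]
    (Fin α → ZMod 3) × (Fin β → Fin 3 → ZMod 3) where
  toFun v := (fun i => v (Sum.inl i),
    fun j k => v (Sum.inr (Sum.inl j)) + v (Sum.inr (Sum.inr j)) * ((k : ℕ) : ZMod 3))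
  map_add' v w := by
    ext
    · simp
    · simp; ring
  map_smul' c w := by
    ext
    · simp
    · simp; ring

lemma Lmap_inj (α β : ℕ) : Function.Injective (Lmap α β) := by
  intro v w h
  have h1 : ∀ i, v (Sum.inl i) = w (Sum.inl i) := fun i => congrFun (congrArg Prod.fst h) i
  have h2 : ∀ j (k : Fin 3), v (Sum.inr (Sum.inl j)) + v (Sum.inr (Sum.inr j)) * ((k : ℕ) : ZMod 3)
    = w (Sum.inr (Sum.inl j)) + w (Sum.inr (Sum.inr j)) * ((k : ℕ) : ZMod 3) :=
    fun j k => congrFun (congrFun (congrArg Prod.snd h) j) k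
  funext t
  rcases t with i | j | j
  · exact h1 i
  · simpa using h2 j 0
  · have a := h2 j 0
    have b := h2 j 1
    simp at a b
    rw [a] at b
    simpa using b

/-- coordinate vectors -/
def Mfam {α β : ℕ} (ψ : SS γ δ →+ (Fin α → ZMod 3) × (Fin β → ZMod 9)) (s : SS γ δ) :
    Fin α ⊕ (Fin β ⊕ Fin β) → ZMod 3 :=
  Sum.elim (ψ s).1 (Sum.elim (fun j => hi ((ψ s).2 j)) (fun j => lo ((ψ s).2 j)))

lemma rank_eq {α β : ℕ} (ψ : SS γ δ →+ (Fin α → ZMod 3) × (Fin β → ZMod 9)) :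
    Module.finrank (ZMod 3) (Submodule.span (ZMod 3) (Gray3 α β '' (Set.range ψ))) =
    Module.finrank (ZMod 3) (CS ψ) := by
  have h1 : Gray3 α β '' (Set.range ψ) = Lmap α β '' Set.range (Mfam ψ) := by
    rw [← Set.range_comp, ← Set.range_comp]
    rfl
  rw [h1, ← Submodule.map_span,
    ← (Submodule.equivMapOfInjective (Lmap α β) (Lmap_inj α β) _).finrank_eq, rowcol]
  have : (fun i s => Mfam ψ s i) = Sum.elim (fun i s => (ψ s).1 i)
      (Sum.elim (fun j s => hi ((ψ s).2 j)) (fun j s => lo ((ψ s).2 j))) := by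
    funext t s
    rcases t with i | j | j <;> rfl
  rw [this, Set.Sum.elim_range, Set.Sum.elim_range, Submodule.span_union, Submodule.span_union]
  rfl

lemma finrank_sup_le {V : Type*} [AddCommGroup V] [Module (ZMod 3) V] [Module.Finite (ZMod 3) V]
    (A B : Submodule (ZMod 3) V) : Module.finrank (ZMod 3) ↥(A ⊔ B) ≤
    Module.finrank (ZMod 3) A + Module.finrank (ZMod 3) B := by
  have := Submodule.finrank_sup_add_finrank_inf_eq A B
  omega

/-- components -/
def xcomp {α β : ℕ} (ψ : SS γ δ →+ (Fin α → ZMod 3) × (Fin β → ZMod 9)) (i : Fin α) :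
    SS γ δ →+ ZMod 3 := (Pi.evalAddMonoidHom _ i).comp ((AddMonoidHom.fst _ _).comp ψ)
/-- components -/
def ycomp {α β : ℕ} (ψ : SS γ δ →+ (Fin α → ZMod 3) × (Fin β → ZMod 9)) (i : Fin β) :
    SS γ δ →+ ZMod 9 := (Pi.evalAddMonoidHom _ i).comp ((AddMonoidHom.snd _ _).comp ψ)

lemma upper2 {α β : ℕ} (ψ : SS γ δ →+ (Fin α → ZMod 3) × (Fin β → ZMod 9)) :
    CS ψ ≤ Psp γ δ := by
  refine sup_le ?_ (sup_le ?_ ?_) <;> refine Submodule.span_le.2 ?_ <;> rintro _ ⟨i, rfl⟩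
  · have := add_mem (Lsp_le (x_sub_mem (xcomp ψ i))) (span_mu_le (xpart_mem (xcomp ψ i)))
    rw [sub_add_cancel] at this
    exact this
  · exact (hom_mem_Bset (ycomp ψ i)).2
  · exact Lsp_le (hom_mem_Bset (ycomp ψ i)).1

lemma upper1 {α β : ℕ} (ψ : SS γ δ →+ (Fin α → ZMod 3) × (Fin β → ZMod 9)) :
    Module.finrank (ZMod 3) (CS ψ) ≤ β + δ + Module.finrank (ZMod 3)
    (Submodule.span (ZMod 3) (Set.range fun s : SS γ δ => (ψ (s.1, 0)).1)) := by
  rw [rowcol]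
  set X := Submodule.span (ZMod 3) (Set.range fun (i : Fin α) (s : SS γ δ) => (ψ (s.1, 0)).1 i)
  set Y : Submodule (ZMod 3) (FS γ δ) :=
    Submodule.span (ZMod 3) (Set.range fun (j : Fin β) s => hi ((ψ s).2 j))
  have h : CS ψ ≤ (Y ⊔ Lsp γ δ) ⊔ X := by
    refine sup_le ?_ (sup_le (le_sup_left.trans le_sup_left) ?_) <;>
      refine Submodule.span_le.2 ?_ <;> rintro _ ⟨i, rfl⟩
    · have h1 : xpart (xcomp ψ i) ∈ X := Submodule.subset_span ⟨i, rfl⟩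
      have h2 := x_sub_mem (xcomp ψ i)
      have := add_mem ((le_sup_right.trans le_sup_left : Lsp γ δ ≤ (Y ⊔ Lsp γ δ) ⊔ X) h2)
        ((le_sup_right : X ≤ (Y ⊔ Lsp γ δ) ⊔ X) h1)
      rw [sub_add_cancel] at this
      exact this
    · exact (le_sup_right.trans le_sup_left : Lsp γ δ ≤ (Y ⊔ Lsp γ δ) ⊔ X)
        (hom_mem_Bset (ycomp ψ i)).1
  have hY : Module.finrank (ZMod 3) Y ≤ β :=
    (finrank_range_le_card (R := ZMod 3) (fun (j : Fin β) (s : SS γ δ) => hi ((ψ s).2 j))).trans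
      (by simp)
  have hL : Module.finrank (ZMod 3) (Lsp γ δ) ≤ δ :=
    (finrank_range_le_card (R := ZMod 3) (lam : Fin δ → FS γ δ)).trans (by simp)
  have h1 := Submodule.finrank_mono h
  have h2 := finrank_sup_le (Y ⊔ Lsp γ δ) X
  have h3 := finrank_sup_le Y (Lsp γ δ)
  exact h1.trans (h2.trans (Nat.add_le_add (h3.trans (Nat.add_le_add hY hL)) le_rfl))

lemma gray3_inj : Function.Injective gray3 := by decide

lemma Gray3_inj (α β : ℕ) : Function.Injective (Gray3 α β) := by
  intro u v h
  have h1 := congrArg Prod.fst h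
  have h2 := congrArg Prod.snd h
  exact Prod.ext h1 (funext fun j => gray3_inj (congrFun h2 j))

lemma lower {α β : ℕ} (ψ : SS γ δ →+ (Fin α → ZMod 3) × (Fin β → ZMod 9))
    (hψ : Function.Injective ψ) : γ + 2 * δ ≤ 
    Module.finrank (ZMod 3) (Submodule.span (ZMod 3) (Gray3 α β '' (Set.range ψ))) := by
  apply card_le_span
  rw [Nat.card_image_of_injective (Gray3_inj α β), Nat.card_range_of_injective hψ, card_SS]

lemma three_smul_tor (m : Fin γ → ZMod 3) : 3 • ((m, 0) : SS γ δ) = 0 := by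
  ext k
  · simp only [Prod.smul_fst, Pi.smul_apply, Prod.fst_zero, Pi.zero_apply]
    exact (by decide : ∀ x : ZMod 3, 3 • x = 0) _
  · simp

lemma forward {α β : ℕ} (𝒞 : AddSubgroup ((Fin α → ZMod 3) × (Fin β → ZMod 9)))
    (e : 𝒞 ≃+ SS γ δ) :
    γ + 2 * δ ≤ Module.finrank (ZMod 3) (Submodule.span (ZMod 3) (Gray3 α β '' (𝒞 : Set _))) ∧
    Module.finrank (ZMod 3) (Submodule.span (ZMod 3) (Gray3 α β '' (𝒞 : Set _))) ≤
     min (β + δ + kappa3 α β 𝒞) (γ + δ + Nat.choose (δ + 1) 2 + Nat.choose (δ + 2) 3) := by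
  let ψ : SS γ δ →+ (Fin α → ZMod 3) × (Fin β → ZMod 9) :=
    𝒞.subtype.comp e.symm.toAddMonoidHom
  have hψ : Function.Injective ψ := Subtype.val_injective.comp e.symm.injective
  have hr : (𝒞 : Set _) = Set.range ψ := by
    ext u
    constructor
    · intro hu
      exact ⟨e ⟨u, hu⟩, by simp [ψ]⟩
    · rintro ⟨s, rfl⟩
      exact (e.symm s).2
  rw [hr]
  refine ⟨lower ψ hψ, le_min ?_ ?_⟩
  · rw [rank_eq]
    refine (upper1 ψ).trans ?_
    gcongr
    unfold kappa3
    apply Submodule.finrank_mono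
    apply Submodule.span_mono
    rintro _ ⟨s, rfl⟩
    refine ⟨ψ (s.1, 0), ⟨(e.symm _).2, ?_⟩, rfl⟩
    rw [← map_nsmul, three_smul_tor, map_zero]
  · rw [rank_eq]
    exact (Submodule.finrank_mono (upper2 ψ)).trans (finrank_Psp_le γ δ)

lemma indep_mono {T : Type*} [Fintype T] (E : T → (Fin δ →₀ ℕ)) (hE : Function.Injective E)
    (h2 : ∀ t i, E t i ≤ 2) :
    LinearIndependent (ZMod 3) (fun t => ∏ i, (lam i : FS γ δ) ^ (E t i)) := by
  classical
  rw [Fintype.linearIndependent_iff]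
  intro c hc t
  let p : MvPolynomial (Fin δ) (ZMod 3) := ∑ t, MvPolynomial.monomial (E t) (c t)
  have hp : p = 0 := by
    apply MvPolynomial.eq_zero_of_eval_eq_zero
    · intro x
      let s : SS γ δ := (0, fun i => ((x i).val : ZMod 9))
      have hs : ∀ i, lam i s = x i := fun i =>
        (by decide : ∀ x : ZMod 3, lo ((x.val : ℕ) : ZMod 9) = x) (x i)
      have := congrFun hc s
      simp only [Finset.sum_apply, Pi.smul_apply, Finset.prod_apply, Pi.pow_apply, hs] at this
      simp only [p, map_sum, MvPolynomial.eval_monomial]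
      rw [← Pi.zero_apply (M := fun _ => ZMod 3) s, ← this]
      refine Finset.sum_congr rfl fun t _ => ?_
      rw [Finsupp.prod_fintype _ _ (by simp)]
      rfl
    · refine sum_mem fun t _ => ?_
      rw [MvPolynomial.mem_restrictDegree]
      intro m hm i
      have := MvPolynomial.support_monomial_subset hm
      simp at this
      subst this
      simpa using h2 t i
  have := congrArg (MvPolynomial.coeff (E t)) hp
  simp only [p, MvPolynomial.coeff_sum, MvPolynomial.coeff_monomial, hE.eq_iff,
    MvPolynomial.coeff_zero] at this
  simpa using this

/-- reduce an exponent -/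
def red (n : ℕ) : ℕ := if n = 3 then 1 else n

lemma pow_red (x : ZMod 3) (n : ℕ) : x ^ red n = x ^ n := by
  unfold red
  split_ifs with h
  · subst h; revert x; decide
  · rfl

/-- reduced exponent vector -/
noncomputable def expo (m : Multiset (Fin δ)) : Fin δ →₀ ℕ :=
  Finsupp.equivFunOnFinite.symm fun i => red (m.count i)

lemma mono_eq {k : ℕ} (m : Sym (Fin δ) k) :
    mono γ δ k m = ∏ i, (lam i : FS γ δ) ^ (expo m.1 i) := by
  funext s
  simp only [Finset.prod_apply, Pi.pow_apply]
  simp only [expo, Finsupp.equivFunOnFinite_symm_apply_apply, pow_red]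
  have : mono γ δ k m = ∏ i, (lam i : FS γ δ) ^ (m.1.count i) := by
    unfold mono
    rw [Finset.prod_multiset_map_count]
    refine Finset.prod_subset (Finset.subset_univ _) ?_
    intro i _ hi
    rw [Multiset.mem_toFinset] at hi
    rw [Multiset.count_eq_zero_of_notMem hi, pow_zero]
  rw [this]
  simp [Finset.prod_apply]

lemma expo_le {m : Multiset (Fin δ)} (h : m.card ≤ 3) (i : Fin δ) : expo m i ≤ 2 := by
  have := Multiset.count_le_card i m
  simp only [expo, Finsupp.equivFunOnFinite_symm_apply_apply, red]
  split_ifs <;> omega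

lemma expo_case {m : Multiset (Fin δ)} (h : m.card ≤ 3) :
    (∃ i, m = Multiset.replicate 3 i ∧ ∑ j, expo m j = 1 ∧ expo m i = 1) ∨ 
    ((∀ i, expo m i = m.count i) ∧ ∑ j, expo m j = m.card) := by
  by_cases h3 : ∃ i, m.count i = 3
  · left
    obtain ⟨i, hi⟩ := h3
    have : m = Multiset.replicate 3 i := by
      symm
      apply Multiset.eq_of_le_of_card_le
      · rw [← hi]; exact Multiset.le_count_iff_replicate_le.1 le_rfl
      · simpa using h
    refine ⟨i, this, ?_, ?_⟩
    · rw [Finset.sum_eq_single i]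
      · simp [expo, hi, red]
      · intro j _ hj
        simp only [expo, Finsupp.equivFunOnFinite_symm_apply_apply]
        rw [this, Multiset.count_replicate, if_neg hj.symm]
        rfl
      · simp
    · simp [expo, hi, red]
  · right
    push Not at h3
    have : ∀ i, expo m i = m.count i := fun i => by simp [expo, red, h3 i]
    refine ⟨this, ?_⟩
    simp only [this]
    exact Multiset.sum_count_eq_card (by simp)

lemma expo_inj {m n : Multiset (Fin δ)} (hm : m.card = 2 ∨ m.card = 3) (hn : n.card = 2 ∨ n.card = 3)
    (h : expo m = expo n) : m = n := by
  rcases expo_case (m := m) (by omega) with ⟨i, h1, h2, h3⟩ | ⟨h1, h2⟩ <;>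
  rcases expo_case (m := n) (by omega) with ⟨j, k1, k2, k3⟩ | ⟨k1, k2⟩
  · by_cases hij : i = j
    · rw [h1, k1, hij]
    · exfalso
      have : expo n i = 0 := by
        simp only [expo, Finsupp.equivFunOnFinite_symm_apply_apply]
        rw [k1, Multiset.count_replicate, if_neg (Ne.symm hij)]
        rfl
      rw [h] at h3
      omega
  · rw [h] at h2; omega
  · rw [h] at h2; omega
  · ext i
    rw [← h1, ← k1, h]

/-- restriction to vanishing torsion coordinates and high digits -/
def restr (γ δ : ℕ) : FS γ δ →ₗ[ZMod 3] FS γ δ :=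
  LinearMap.funLeft (ZMod 3) (ZMod 3) (fun s : SS γ δ => ((0, fun i => (((s.2 i).val % 3 : ℕ) : ZMod 9)) : SS γ δ))

lemma restr_lam (i : Fin δ) : restr γ δ (lam i) = lam i := by
  funext s
  exact (by decide : ∀ x : ZMod 9, lo ((x.val % 3 : ℕ) : ZMod 9) = lo x) (s.2 i)

lemma restr_mul (f g : FS γ δ) : restr γ δ (f * g) = restr γ δ f * restr γ δ g := rfl

lemma restr_mono {k : ℕ} (m : Sym (Fin δ) k) : restr γ δ (mono γ δ k m) = mono γ δ k m := by
  unfold mono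
  generalize m.1 = n
  induction n using Multiset.induction_on with
  | empty => rfl
  | cons a n ih => simp only [Multiset.map_cons, Multiset.prod_cons, restr_mul, ih, restr_lam]

lemma indep_base : LinearIndependent (ZMod 3)
    (Sum.elim mu lam2 : Fin γ ⊕ Fin δ → FS γ δ) := by
  rw [Fintype.linearIndependent_iff]
  intro c hc t
  simp only [Fintype.sum_sum_type, Sum.elim_inl, Sum.elim_inr] at hc
  rcases t with j | i
  · have := congrFun hc (Pi.single j 1, 0)
    simpa [Finset.sum_apply, mu, lam2, Pi.single_apply, show hi 0 = 0 by decide] using this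
  · have := congrFun hc (0, Pi.single i 3)
    simpa [Finset.sum_apply, mu, lam2, Pi.single_apply, apply_ite hi, show hi 0 = 0 by decide,
      show hi 3 = 1 by decide] using this

lemma indep_fam (γ δ : ℕ) : LinearIndependent (ZMod 3) (fam γ δ) := by
  refine LinearIndependent.sum_type indep_base ?_ ?_
  · let E : Sym (Fin δ) 2 ⊕ Sym (Fin δ) 3 → (Fin δ →₀ ℕ) :=
      Sum.elim (fun m => expo m.1) (fun m => expo m.1)
    have h := indep_mono (γ := γ) E ?_ ?_
    · have he : Sum.elim (mono γ δ 2) (mono γ δ 3) =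
          fun t => ∏ i, (lam i : FS γ δ) ^ (E t i) := by
        funext t
        rcases t with m | m <;> exact mono_eq m
      rw [he]
      exact h
    · rintro (m | m) (n | n) h
      · exact congrArg Sum.inl (Subtype.ext (expo_inj (Or.inl m.2) (Or.inl n.2) h))
      · have := congrArg Multiset.card (expo_inj (Or.inl m.2) (Or.inr n.2) h)
        rw [m.2, n.2] at this
        omega
      · have := congrArg Multiset.card (expo_inj (Or.inr m.2) (Or.inl n.2) h)
        rw [m.2, n.2] at this
        omega
      · exact congrArg Sum.inr (Subtype.ext (expo_inj (Or.inr m.2) (Or.inr n.2) h))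
    · rintro (m | m) i
      · exact expo_le (by rw [m.2]; norm_num) i
      · exact expo_le (by rw [m.2]) i
  · rw [Submodule.disjoint_def]
    intro f h1 h2
    have a1 : restr γ δ f = 0 := by
      have : Submodule.span (ZMod 3) (Set.range (Sum.elim mu lam2 : Fin γ ⊕ Fin δ → FS γ δ)) ≤
          LinearMap.ker (restr γ δ) := by
        refine Submodule.span_le.2 ?_
        rintro _ ⟨j | i, rfl⟩
        · rfl
        · rw [SetLike.mem_coe, LinearMap.mem_ker]
          funext s
          exact (by decide : ∀ x : ZMod 9, hi ((x.val % 3 : ℕ) : ZMod 9) = 0) (s.2 i)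
      exact this h1
    have a2 : restr γ δ f = f := by
      have : Submodule.span (ZMod 3) (Set.range (Sum.elim (mono γ δ 2) (mono γ δ 3))) ≤
          LinearMap.eqLocus (restr γ δ) LinearMap.id := by
        refine Submodule.span_le.2 ?_
        rintro _ ⟨j | i, rfl⟩
        · exact restr_mono j
        · exact restr_mono i
      exact this h2
    rw [← a2, a1]

lemma finrank_Psp (γ δ : ℕ) : Module.finrank (ZMod 3) (Psp γ δ)
    = γ + δ + Nat.choose (δ + 1) 2 + Nat.choose (δ + 2) 3 := by
  rw [← card_fam]; exact finrank_span_eq_card (indep_fam γ δ)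

lemma exch {V : Type*} [AddCommGroup V] [Module (ZMod 3) V] [Module.Finite (ZMod 3) V]
    (W : Submodule (ZMod 3) V) (F : Set V) (n : ℕ)
    (h : Module.finrank (ZMod 3) W + n ≤ Module.finrank (ZMod 3) ↥(W ⊔ Submodule.span (ZMod 3) F)) :
    ∃ c : Fin n → V, (∀ k, c k ∈ F) ∧
      Module.finrank (ZMod 3) ↥(W ⊔ Submodule.span (ZMod 3) (Set.range c)) =
        Module.finrank (ZMod 3) W + n := by
  induction n with
  | zero =>
    refine ⟨Fin.elim0, fun k => k.elim0, ?_⟩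
    rw [Set.range_eq_empty, Submodule.span_empty, sup_bot_eq]
    rfl
  | succ n ih =>
    obtain ⟨c, hc, hr⟩ := ih (by omega)
    set U := W ⊔ Submodule.span (ZMod 3) (Set.range c) with hU
    have hex : ∃ f ∈ F, f ∉ U := by
      by_contra! hcon
      have hle : W ⊔ Submodule.span (ZMod 3) F ≤ U :=
        sup_le le_sup_left (Submodule.span_le.2 hcon)
      have := Submodule.finrank_mono hle
      have h' := h.trans (this.trans hr.le)
      omega
    obtain ⟨f, hf, hfU⟩ := hex
    refine ⟨Fin.cons f c, ?_, ?_⟩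
    · intro k
      refine Fin.cases ?_ (fun i => ?_) k
      · simpa using hf
      · simpa using hc i
    · have he : W ⊔ Submodule.span (ZMod 3) (Set.range (Fin.cons f c : Fin (n + 1) → V)) =
          U ⊔ Submodule.span (ZMod 3) {f} := by
        rw [Fin.range_cons, Submodule.span_insert, hU, sup_assoc,
          sup_comm (Submodule.span (ZMod 3) {f})]
      rw [he]
      have hlt : U < U ⊔ Submodule.span (ZMod 3) {f} := by
        refine lt_of_le_of_ne le_sup_left fun hEq => hfU ?_
        rw [hEq]
        exact (le_sup_right : _ ≤ U ⊔ Submodule.span (ZMod 3) {f})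
          (Submodule.mem_span_singleton_self f)
      have a1 := Submodule.finrank_lt_finrank_of_lt hlt
      have a2 := finrank_sup_le U (Submodule.span (ZMod 3) {f})
      have a3 : Module.finrank (ZMod 3) (Submodule.span (ZMod 3) {f}) ≤ 1 :=
        (finrank_span_le_card (R := ZMod 3) ({f} : Set V)).trans (by simp)
      refine le_antisymm ?_ ?_
      · refine a2.trans ((Nat.add_le_add hr.le a3).trans ?_)
        omega
      · refine le_trans ?_ (Nat.succ_le_of_lt a1)
        rw [← add_assoc]
        exact Nat.succ_le_succ hr.ge

/-- baseline space -/
def W0 (γ δ : ℕ) : Submodule (ZMod 3) (FS γ δ) := CS (AddMonoidHom.id (SS γ δ))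

lemma W0_eq : W0 γ δ = Submodule.span (ZMod 3) (Set.range (mu : Fin γ → FS γ δ)) ⊔
    (Submodule.span (ZMod 3) (Set.range (lam2 : Fin δ → FS γ δ)) ⊔ Lsp γ δ) := rfl

lemma finrank_W0 : Module.finrank (ZMod 3) (W0 γ δ) = γ + 2 * δ := by
  refine le_antisymm ?_ ?_
  · have h1 := finrank_sup_le (Submodule.span (ZMod 3) (Set.range (mu : Fin γ → FS γ δ)))
      (Submodule.span (ZMod 3) (Set.range (lam2 : Fin δ → FS γ δ)) ⊔ Lsp γ δ)
    have h2 := finrank_sup_le (Submodule.span (ZMod 3) (Set.range (lam2 : Fin δ → FS γ δ)))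
      (Lsp γ δ)
    have k1 := (finrank_range_le_card (R := ZMod 3) (mu : Fin γ → FS γ δ)).trans
      (Fintype.card_fin _).le
    have k2 := (finrank_range_le_card (R := ZMod 3) (lam2 : Fin δ → FS γ δ)).trans
      (Fintype.card_fin _).le
    have k3 := (finrank_range_le_card (R := ZMod 3) (lam : Fin δ → FS γ δ)).trans
      (Fintype.card_fin _).le
    have := h1.trans (Nat.add_le_add k1 (h2.trans (Nat.add_le_add k2 k3)))
    refine this.trans ?_
    omega
  · have := lower (AddMonoidHom.id (SS γ δ)) Function.injective_id
    rw [rank_eq] at this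
    exact this

/-- all high digit functions of homomorphisms -/
def Fset (γ δ : ℕ) : Set (FS γ δ) := {f | ∃ g : SS γ δ →+ ZMod 9, (fun s => hi (g s)) = f}

/-- total space -/
def Tot (γ δ : ℕ) : Submodule (ZMod 3) (FS γ δ) := W0 γ δ ⊔ Submodule.span (ZMod 3) (Fset γ δ)

/-- low digits of a hom -/
def log (g : SS γ δ →+ ZMod 9) : FS γ δ := fun s => lo (g s)

lemma hi_mem_Tot (g : SS γ δ →+ ZMod 9) : (fun s => hi (g s)) ∈ Tot γ δ :=
  (le_sup_right : _ ≤ Tot γ δ) (Submodule.subset_span ⟨g, rfl⟩)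

lemma cross (g h : SS γ δ →+ ZMod 9) :
    (2 : ZMod 3) • (log g * log h) - log g * log g * log h - log g * log h * log h ∈ Tot γ δ := by
  have := sub_mem (sub_mem (hi_mem_Tot (g + h)) (hi_mem_Tot g)) (hi_mem_Tot h)
  convert this using 1
  funext s
  have := hi_add (g s) (h s)
  simp only [Pi.sub_apply, Pi.smul_apply, Pi.mul_apply, AddMonoidHom.add_apply, log, this, smul_eq_mul]
  ring

lemma cross3 (g h : SS γ δ →+ ZMod 9) : log g * log h * log h ∈ Tot γ δ := by
  have := add_mem (cross g h) (cross g (-h))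
  convert this using 1
  funext s
  simp only [Pi.sub_apply, Pi.add_apply, Pi.smul_apply, Pi.mul_apply, AddMonoidHom.neg_apply, log,
    lo_neg, smul_eq_mul]
  exact (by decide : ∀ a b : ZMod 3, a * b * b = 2 * (a * b) - a * a * b - a * b * b +
    (2 * (a * -b) - a * a * -b - a * -b * -b)) _ _

lemma cross2 (g h : SS γ δ →+ ZMod 9) : log g * log h ∈ Tot γ δ := by
  have := (Tot γ δ).smul_mem 2 (add_mem (add_mem (cross g h) (cross3 g h)) (cross3 h g))
  convert this using 1
  funext s
  simp only [Pi.sub_apply, Pi.add_apply, Pi.smul_apply, Pi.mul_apply, smul_eq_mul]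
  exact (by decide : ∀ a b : ZMod 3, a * b = 2 * (2 * (a * b) - a * a * b - a * b * b + a * b * b +
    b * a * a)) _ _

lemma cross111 (g h k : SS γ δ →+ ZMod 9) : log g * log h * log k ∈ Tot γ δ := by
  have := (Tot γ δ).smul_mem 2 (sub_mem (sub_mem (cross3 k (g + h)) (cross3 k g)) (cross3 k h))
  convert this using 1
  funext s
  simp only [Pi.sub_apply, Pi.add_apply, Pi.smul_apply, Pi.mul_apply, smul_eq_mul, log,
    AddMonoidHom.add_apply, lo_add]
  exact (by decide : ∀ a b c : ZMod 3, a * b * c = 2 * (c * (a + b) * (a + b) - c * a * a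
    - c * b * b)) _ _ _

/-- coordinate hom -/
def yhom (i : Fin δ) : SS γ δ →+ ZMod 9 := ycomp (AddMonoidHom.id (SS γ δ)) i

lemma Psp_le_Tot : Psp γ δ ≤ Tot γ δ := by
  have hW : W0 γ δ ≤ Tot γ δ := le_sup_left
  refine Submodule.span_le.2 ?_
  rintro _ ⟨(j | i) | (m | m), rfl⟩
  · apply hW
    rw [W0_eq]
    exact Submodule.mem_sup_left (Submodule.subset_span ⟨j, rfl⟩)
  · apply hW
    rw [W0_eq]
    exact Submodule.mem_sup_right (Submodule.mem_sup_left (Submodule.subset_span ⟨i, rfl⟩))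
  · obtain ⟨m, hm⟩ := m
    obtain ⟨a, b, rfl⟩ := Multiset.card_eq_two.1 hm
    have : (Multiset.map lam {a, b}).prod = log (yhom a) * (log (yhom b) : FS γ δ) := by
      simp
      rfl
    change (Multiset.map lam {a, b}).prod ∈ Tot γ δ
    rw [this]
    exact cross2 _ _
  · obtain ⟨m, hm⟩ := m
    obtain ⟨a, b, c, rfl⟩ := Multiset.card_eq_three.1 hm
    have : (Multiset.map lam {a, b, c}).prod =
        log (yhom a) * (log (yhom b) : FS γ δ) * log (yhom c) := by
      simp [mul_assoc]
      rfl
    change (Multiset.map lam {a, b, c}).prod ∈ Tot γ δ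
    rw [this]
    exact cross111 _ _ _

lemma exists_cols (γ δ e : ℕ)
    (h : γ + 2 * δ + e ≤ γ + δ + Nat.choose (δ + 1) 2 + Nat.choose (δ + 2) 3) :
    ∃ g : Fin e → (SS γ δ →+ ZMod 9), Module.finrank (ZMod 3)
      ↥(W0 γ δ ⊔ Submodule.span (ZMod 3) (Set.range fun k s => hi (g k s))) = γ + 2 * δ + e := by
  have h1 : Module.finrank (ZMod 3) (W0 γ δ) + e ≤ Module.finrank (ZMod 3) (Tot γ δ) := by
    rw [finrank_W0]
    refine h.trans ?_
    rw [← finrank_Psp]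
    exact Submodule.finrank_mono Psp_le_Tot
  obtain ⟨c, hc, hr⟩ := exch (W0 γ δ) (Fset γ δ) e h1
  choose g hg using hc
  refine ⟨g, ?_⟩
  have : (fun k s => hi (g k s)) = c := funext hg
  rw [this]
  rw [finrank_W0] at hr
  exact hr

lemma extend_cols {T A : Type*} [Fintype T] [Zero A] (n : ℕ) (h : Fintype.card T ≤ n) (G : T → A) :
    ∃ H : Fin n → A, (∀ t, ∃ j, H j = G t) ∧ ∀ j, H j = 0 ∨ ∃ t, H j = G t := by
  classical
  obtain ⟨f⟩ := Function.Embedding.nonempty_of_card_le (α := T) (β := Fin n) (by simpa using h)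
  refine ⟨Function.extend f G 0, fun t => ⟨f t, f.injective.extend_apply _ _ _⟩, fun j => ?_⟩
  by_cases hj : ∃ t, f t = j
  · obtain ⟨t, rfl⟩ := hj
    exact Or.inr ⟨t, f.injective.extend_apply _ _ _⟩
  · exact Or.inl (Function.extend_apply' _ _ _ hj)

/-- the hom `a ↦ 3a` -/
def tri : ZMod 3 →+ ZMod 9 := AddMonoidHom.mk' (fun a => 3 * (a.val : ZMod 9)) (by decide)

lemma hi_tri : ∀ a : ZMod 3, hi (tri a) = a := by decide

/-- coordinate hom -/
def xhom (j : Fin γ) : SS γ δ →+ ZMod 3 := xcomp (AddMonoidHom.id (SS γ δ)) j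

/-- extension by zero -/
def extz (α κ : ℕ) : (Fin κ → ZMod 3) →ₗ[ZMod 3] (Fin α → ZMod 3) where
  toFun v := fun i => if h : i.1 < κ then v ⟨i.1, h⟩ else 0
  map_add' v w := by
    funext i
    by_cases h : i.1 < κ <;> simp [h]
  map_smul' c v := by
    funext i
    by_cases h : i.1 < κ <;> simp [h]

lemma extz_inj {α κ : ℕ} (h : κ ≤ α) : Function.Injective (extz α κ) := by
  intro v w hvw
  funext i
  have := congrFun hvw ⟨i.1, i.2.trans_le h⟩
  simpa [extz] using this

lemma backward (α β γ δ κ e : ℕ) (hα : κ ≤ α) (hγ : κ ≤ γ) (hβ : γ + δ + e ≤ β + κ)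
    (h : γ + 2 * δ + e ≤ γ + δ + Nat.choose (δ + 1) 2 + Nat.choose (δ + 2) 3) :
    ∃ 𝒞 : AddSubgroup ((Fin α → ZMod 3) × (Fin β → ZMod 9)),
        Nonempty (𝒞 ≃+ SS γ δ) ∧ kappa3 α β 𝒞 = κ ∧
        Module.finrank (ZMod 3) (Submodule.span (ZMod 3)
              (Gray3 α β '' (𝒞 : Set ((Fin α → ZMod 3) × (Fin β → ZMod 9))))) = γ + 2 * δ + e := by
  obtain ⟨g, hg⟩ := exists_cols γ δ e h
  let G : Fin (γ - κ) ⊕ (Fin δ ⊕ Fin e) → (SS γ δ →+ ZMod 9) :=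
    Sum.elim (fun j => tri.comp (xhom ⟨κ + j.1, by have := j.2; omega⟩)) (Sum.elim yhom g)
  obtain ⟨H, hH1, hH2⟩ := extend_cols β (by simp; omega) G
  let X : Fin α → (SS γ δ →+ ZMod 3) :=
    fun i => if h : i.1 < κ then xhom ⟨i.1, h.trans_le hγ⟩ else 0
  let ψ : SS γ δ →+ (Fin α → ZMod 3) × (Fin β → ZMod 9) :=
    (AddMonoidHom.mk' (fun s i => X i s) (fun a b => funext fun i => map_add _ _ _)).prod
    (AddMonoidHom.mk' (fun s i => H i s) (fun a b => funext fun i => map_add _ _ _))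
  have hψ1 : ∀ s i, (ψ s).1 i = X i s := fun _ _ => rfl
  have hψ2 : ∀ s j, (ψ s).2 j = H j s := fun _ _ => rfl
  have hX1 : ∀ (j : Fin γ) (hj : j.1 < κ), X ⟨j.1, hj.trans_le hα⟩ = xhom j := by
    intro j hj
    simp [X, hj]
  have hmu : ∀ j : Fin γ, κ ≤ j.1 → ∃ i, H i = tri.comp (xhom j) := by
    intro j hj
    obtain ⟨i, hi⟩ := hH1 (Sum.inl ⟨j.1 - κ, by have := j.2; omega⟩)
    refine ⟨i, ?_⟩
    rw [hi]
    simp only [G, Sum.elim_inl]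
    congr 2
    apply Fin.ext
    simp
    omega
  have hyy : ∀ i : Fin δ, ∃ j, H j = yhom i := fun i => hH1 (Sum.inr (Sum.inl i))
  have hgg : ∀ k, ∃ j, H j = g k := fun i => hH1 (Sum.inr (Sum.inr i))
  have hinj : Function.Injective ψ := by
    rw [injective_iff_map_eq_zero]
    intro s hs
    have z1 : ∀ i, X i s = 0 := fun i => by rw [← hψ1, hs]; rfl
    have z2 : ∀ j, H j s = 0 := fun j => by rw [← hψ2, hs]; rfl
    refine Prod.ext (funext fun j => ?_) (funext fun i => ?_)
    · by_cases hj : j.1 < κ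
      · have := z1 ⟨j.1, hj.trans_le hα⟩
        rw [hX1 j hj] at this
        exact this
      · obtain ⟨i, hi⟩ := hmu j (by omega)
        have := z2 i
        rw [hi] at this
        exact (by decide : ∀ a : ZMod 3, tri a = 0 → a = 0) _ this
    · obtain ⟨j, hj⟩ := hyy i
      have := z2 j
      rw [hj] at this
      exact this
  have hCS : CS ψ = W0 γ δ ⊔ Submodule.span (ZMod 3) (Set.range fun k s => hi (g k s)) := by
    apply le_antisymm
    · refine sup_le ?_ (sup_le ?_ ?_) <;> refine Submodule.span_le.2 ?_ <;> rintro _ ⟨i, rfl⟩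
      · simp only [hψ1, X]
        apply Submodule.mem_sup_left
        rw [W0_eq]
        apply Submodule.mem_sup_left
        by_cases hi : i.1 < κ
        · simp only [hi, dif_pos]
          exact Submodule.subset_span ⟨⟨i.1, hi.trans_le hγ⟩, rfl⟩
        · simp only [hi, dif_neg, not_false_eq_true]
          exact Submodule.zero_mem _
      · simp only [hψ2]
        rcases hH2 i with h0 | ⟨t, ht⟩
        · rw [h0]
          have hz : (fun s => hi ((0 : SS γ δ →+ ZMod 9) s)) = 0 :=
            funext fun s => (by decide : hi 0 = 0)
          rw [hz]
          exact zero_mem (W0 γ δ ⊔ Submodule.span (ZMod 3) (Set.range fun k s => hi (g k s)))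
        · rw [ht]
          rcases t with j | i | k
          · apply Submodule.mem_sup_left
            rw [W0_eq]
            apply Submodule.mem_sup_left
            refine Submodule.subset_span ⟨⟨κ + j.1, by have := j.2; omega⟩, ?_⟩
            funext s
            exact (hi_tri _).symm
          · apply Submodule.mem_sup_left
            rw [W0_eq]
            exact Submodule.mem_sup_right (Submodule.mem_sup_left (Submodule.subset_span ⟨i, rfl⟩))
          · exact Submodule.mem_sup_right (Submodule.subset_span ⟨k, rfl⟩)
      · apply Submodule.mem_sup_left
        rw [W0_eq]
        exact Submodule.mem_sup_right (Submodule.mem_sup_right (hom_mem_Bset (H i)).1)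
    · rw [W0_eq]
      refine sup_le (sup_le (Submodule.span_le.2 ?_) (sup_le (Submodule.span_le.2 ?_)
        (show Submodule.span (ZMod 3) (Set.range lam) ≤ _ from Submodule.span_le.2 ?_)))
        (Submodule.span_le.2 ?_) <;>
        rintro _ ⟨i, rfl⟩
      · by_cases hj : i.1 < κ
        · refine Submodule.mem_sup_left (Submodule.subset_span ⟨⟨i.1, hj.trans_le hα⟩, ?_⟩)
          funext s
          change X _ s = _
          rw [hX1 i hj]
          rfl
        · obtain ⟨j, hj⟩ := hmu i (by omega)
          refine Submodule.mem_sup_right (Submodule.mem_sup_left (Submodule.subset_span ⟨j, ?_⟩))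
          funext s
          change hi (H j s) = _
          rw [hj]
          exact hi_tri _
      · obtain ⟨j, hj⟩ := hyy i
        refine Submodule.mem_sup_right (Submodule.mem_sup_left (Submodule.subset_span ⟨j, ?_⟩))
        funext s
        change hi (H j s) = _
        rw [hj]
        rfl
      · obtain ⟨j, hj⟩ := hyy i
        refine Submodule.mem_sup_right (Submodule.mem_sup_right (Submodule.subset_span ⟨j, ?_⟩))
        funext s
        change lo (H j s) = _
        rw [hj]
        rfl
      · obtain ⟨j, hj⟩ := hgg i
        refine Submodule.mem_sup_right (Submodule.mem_sup_left (Submodule.subset_span ⟨j, ?_⟩))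
        funext s
        change hi (H j s) = _
        rw [hj]
  refine ⟨ψ.range, ⟨(AddMonoidHom.ofInjective hinj).symm⟩, ?_, ?_⟩
  · unfold kappa3
    have hset : Prod.fst '' {u : (Fin α → ZMod 3) × (Fin β → ZMod 9) | u ∈ ψ.range ∧ 3 • u = 0} =
        (LinearMap.range (extz α κ) : Set (Fin α → ZMod 3)) := by
      ext x
      constructor
      · rintro ⟨_, ⟨⟨s, rfl⟩, _⟩, rfl⟩
        refine ⟨fun t => s.1 ⟨t.1, t.2.trans_le hγ⟩, ?_⟩
        funext i
        rw [hψ1]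
        by_cases hi : i.1 < κ
        · simp only [extz, X, hi, dif_pos, LinearMap.coe_mk, AddHom.coe_mk]
          rfl
        · simp [extz, X, hi]
      · rintro ⟨v, rfl⟩
        refine ⟨ψ (fun j => if h : j.1 < κ then v ⟨j.1, h⟩ else 0, 0), ⟨⟨_, rfl⟩, ?_⟩, ?_⟩
        · rw [← map_nsmul, three_smul_tor, map_zero]
        · funext i
          rw [hψ1]
          by_cases hi : i.1 < κ
          · simp only [extz, X, hi, dif_pos, LinearMap.coe_mk, AddHom.coe_mk]
            change (if h : i.1 < κ then v ⟨i.1, h⟩ else 0) = _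
            rw [dif_pos hi]
          · simp [extz, X, hi]
    rw [hset, Submodule.span_eq]
    exact (LinearMap.finrank_range_of_inj (extz_inj hα)).trans (by simp)
  · rw [AddMonoidHom.coe_range, rank_eq, hCS, hg]

end helpers

/-- There exists a `Z₃Z₉`-additive code of type `(α, β; γ, δ; κ)` whose Gray image has
rank `r` iff `γ + 2δ ≤ r ≤ min(β + δ + κ, γ + δ + C(δ+1,2) + C(δ+2,3))`. -/
theorem exists_code_with_rank_iff (α β γ δ κ r : ℕ)
    (h1 : α + β > 0) (h2 : 0 < γ + δ) (h3 : γ + δ ≤ β + κ) (h4 : κ ≤ min α γ) :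
    (∃ 𝒞 : AddSubgroup ((Fin α → ZMod 3) × (Fin β → ZMod 9)),
        Nonempty (𝒞 ≃+ (Fin γ → ZMod 3) × (Fin δ → ZMod 9)) ∧
        kappa3 α β 𝒞 = κ ∧
        Module.finrank (ZMod 3)
            (Submodule.span (ZMod 3)
              (Gray3 α β '' (𝒞 : Set ((Fin α → ZMod 3) × (Fin β → ZMod 9))))) = r) ↔
      (γ + 2 * δ ≤ r ∧
        r ≤ min (β + δ + κ) (γ + δ + Nat.choose (δ + 1) 2 + Nat.choose (δ + 2) 3)) := by
  constructor
  · rintro ⟨𝒞, ⟨e⟩, hκ, hr⟩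
    have := forward 𝒞 e
    rw [hκ, hr] at this
    exact this
  · rintro ⟨ha, hb⟩
    obtain ⟨e, rfl⟩ := Nat.exists_eq_add_of_le ha
    have hb1 := hb.trans (min_le_left _ _)
    have hb2 := hb.trans (min_le_right _ _)
    exact backward α β γ δ κ e (h4.trans (min_le_left _ _)) (h4.trans (min_le_right _ _))
      (by omega) hb2
end
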